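/- arXiv:2509.01857 — 3 statements merged into one kernel-verified Lean document; each statement's English description precedes it below -/
import Mathlib

section
/- Let 1 ≤ m ≤ n and π ∈ S_{m,n}. Set F_π := {(X,Y) ∈ E : (YX)_{π(i)π(i)} = (XY)_{ii} for all 1 ≤ i ≤ m, and the scalars (XY)_{11},…,(XY)_{mm} are pairwise distinct and nonzero} and O_π := (B_-×B_+)·{(π, πᵀs) : s an m×m diagonal complex matrix}. Then the Zariski closures of E°_π, of F_π and of O_π all coincide (this common closure being E_π); the lower-upper scheme is the union E = ⋃_{π ∈ S_{m,n}} E_π; and the image of E_π under the projection (X,Y) ↦ X equals the rectangular matrix Schubert variety X̄_π, i.e. the Zariski closure of the set B_- π B_+ := {bπc : b ∈ B_-, c ∈ B_+} in Mat_{m×n}(ℂ). -/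
open Matrix

/-- The ambient space `Mat(m,n,ℂ) × Mat(n,m,ℂ)`. -/
abbrev LUSpace (m n : ℕ) := Matrix (Fin m) (Fin n) ℂ × Matrix (Fin n) (Fin m) ℂ

/-- Lower triangular square matrix. -/
def LowerTri {k : ℕ} (M : Matrix (Fin k) (Fin k) ℂ) : Prop := ∀ i j : Fin k, i < j → M i j = 0

/-- Upper triangular square matrix. -/
def UpperTri {k : ℕ} (M : Matrix (Fin k) (Fin k) ℂ) : Prop := ∀ i j : Fin k, j < i → M i j = 0

/-- The lower-upper scheme `E`. -/
def LU (m n : ℕ) : Set (LUSpace m n) :=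
  { p | LowerTri (p.1 * p.2) ∧ UpperTri (p.2 * p.1) }

/-- The partial permutation matrix associated to `π ∈ S_{m,n}`. -/
def permMat {m n : ℕ} (π : Fin m ↪ Fin n) : Matrix (Fin m) (Fin n) ℂ :=
  fun i j => if π i = j then 1 else 0

/-- Invertible lower triangular m×m matrices. -/
def Bminus (m : ℕ) : Set (Matrix (Fin m) (Fin m) ℂ) := { b | IsUnit b ∧ LowerTri b }

/-- Invertible upper triangular n×n matrices. -/
def Bplus (n : ℕ) : Set (Matrix (Fin n) (Fin n) ℂ) := { c | IsUnit c ∧ UpperTri c }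

/-- Lower unitriangular m×m matrices. -/
def Nminus (m : ℕ) : Set (Matrix (Fin m) (Fin m) ℂ) := { b | LowerTri b ∧ ∀ i, b i i = 1 }

/-- Upper unitriangular n×n matrices. -/
def Nplus (n : ℕ) : Set (Matrix (Fin n) (Fin n) ℂ) := { c | UpperTri c ∧ ∀ j, c j j = 1 }

/-- `E°_π`. -/
def Eopen {m n : ℕ} (π : Fin m ↪ Fin n) : Set (LUSpace m n) :=
  { p | ∃ b ∈ Nminus m, ∃ c ∈ Nplus n, ∃ s t : Fin m → ℂ,
      (∀ i, s i * t i ≠ 0) ∧ (∀ i i' : Fin m, i ≠ i' → s i * t i ≠ s i' * t i') ∧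
      p.1 = b * (Matrix.diagonal s * permMat π) * c⁻¹ ∧
      p.2 = c * ((permMat π)ᵀ * Matrix.diagonal t) * b⁻¹ }

/-- Coordinates of a point of `LUSpace` as a function on the variable-index type. -/
def coordsOf {m n : ℕ} (p : LUSpace m n) : (Fin m × Fin n) ⊕ (Fin n × Fin m) → ℂ
  | .inl ij => p.1 ij.1 ij.2
  | .inr ji => p.2 ji.1 ji.2

/-- Zariski closure of a subset of `LUSpace m n`: the common zero set of all polynomials
vanishing identically on the subset. -/
def zclosure {m n : ℕ} (S : Set (LUSpace m n)) : Set (LUSpace m n) :=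
  { p | ∀ f : MvPolynomial ((Fin m × Fin n) ⊕ (Fin n × Fin m)) ℂ,
      (∀ q ∈ S, MvPolynomial.eval (coordsOf q) f = 0) → MvPolynomial.eval (coordsOf p) f = 0 }

/-- `E_π`, the Zariski closure of `E°_π`. -/
def Ecomp {m n : ℕ} (π : Fin m ↪ Fin n) : Set (LUSpace m n) := zclosure (Eopen π)

/-- Zariski closure in the matrix space `Mat(m,n,ℂ)`. -/
def mzclosure {m n : ℕ} (S : Set (Matrix (Fin m) (Fin n) ℂ)) : Set (Matrix (Fin m) (Fin n) ℂ) :=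
  { X | ∀ f : MvPolynomial (Fin m × Fin n) ℂ,
      (∀ Y ∈ S, MvPolynomial.eval (fun ij => Y ij.1 ij.2) f = 0) →
        MvPolynomial.eval (fun ij => X ij.1 ij.2) f = 0 }

section Triangular

variable {k : ℕ} {A B : Matrix (Fin k) (Fin k) ℂ}

lemma UpperTri.isUpperTriangular (h : UpperTri A) : A.IsUpperTriangular := fun _ _ hij => h _ _ hij

lemma LowerTri.isLowerTriangular (h : LowerTri A) : A.IsLowerTriangular := fun _ _ hij => h _ _ hij

lemma lowerTri_iff_transpose : LowerTri A ↔ UpperTri Aᵀ := forall_comm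

lemma upperTri_iff_transpose : UpperTri A ↔ LowerTri Aᵀ := forall_comm

lemma UpperTri.mul (hA : UpperTri A) (hB : UpperTri B) : UpperTri (A * B) :=
  fun _ _ hij => BlockTriangular.mul hA.isUpperTriangular hB.isUpperTriangular hij

lemma LowerTri.mul (hA : LowerTri A) (hB : LowerTri B) : LowerTri (A * B) :=
  fun _ _ hij => BlockTriangular.mul hA.isLowerTriangular hB.isLowerTriangular hij

lemma UpperTri.add (hA : UpperTri A) (hB : UpperTri B) : UpperTri (A + B) :=
  fun i j hij => by simp [hA i j hij, hB i j hij]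

lemma LowerTri.add (hA : LowerTri A) (hB : LowerTri B) : LowerTri (A + B) :=
  fun i j hij => by simp [hA i j hij, hB i j hij]

lemma UpperTri.smul (ε : ℂ) (hA : UpperTri A) : UpperTri (ε • A) :=
  fun i j hij => by simp [hA i j hij]

lemma LowerTri.smul (ε : ℂ) (hA : LowerTri A) : LowerTri (ε • A) :=
  fun i j hij => by simp [hA i j hij]

lemma upperTri_diagonal (d : Fin k → ℂ) : UpperTri (diagonal d) :=
  fun _ _ hij => diagonal_apply_ne _ hij.ne'

lemma lowerTri_diagonal (d : Fin k → ℂ) : LowerTri (diagonal d) :=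
  fun _ _ hij => diagonal_apply_ne _ hij.ne

lemma upperTri_one : UpperTri (1 : Matrix (Fin k) (Fin k) ℂ) :=
  fun _ _ hij => one_apply_ne hij.ne'

lemma lowerTri_one : LowerTri (1 : Matrix (Fin k) (Fin k) ℂ) :=
  fun _ _ hij => one_apply_ne hij.ne

lemma UpperTri.inv (hA : UpperTri A) : UpperTri A⁻¹ := by
  by_cases h : IsUnit A
  · have := h.invertible
    exact fun i j hij => blockTriangular_inv_of_blockTriangular hA.isUpperTriangular hij
  · rw [nonsing_inv_eq_ringInverse, Ring.inverse_non_unit _ h]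
    exact fun i j hij => rfl

lemma LowerTri.inv (hA : LowerTri A) : LowerTri A⁻¹ := by
  rw [lowerTri_iff_transpose, transpose_nonsing_inv]
  exact (lowerTri_iff_transpose.1 hA).inv

lemma UpperTri.mul_apply_self (hA : UpperTri A) (hB : UpperTri B) (i : Fin k) :
    (A * B) i i = A i i * B i i := by
  rw [Matrix.mul_apply]
  refine Finset.sum_eq_single i (fun j _ hj => ?_) (by simp)
  rcases lt_or_gt_of_ne hj with h | h
  · simp [hA i j h]
  · simp [hB j i h]

lemma LowerTri.mul_apply_self (hA : LowerTri A) (hB : LowerTri B) (i : Fin k) :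
    (A * B) i i = A i i * B i i := by
  have := (lowerTri_iff_transpose.1 hB).mul_apply_self (lowerTri_iff_transpose.1 hA) i
  rw [← transpose_mul] at this
  simpa [mul_comm] using this

lemma UpperTri.isUnit_of_diag_ne_zero (hA : UpperTri A) (h : ∀ i, A i i ≠ 0) : IsUnit A := by
  rw [isUnit_iff_isUnit_det, det_of_isUpperTriangular hA.isUpperTriangular, isUnit_iff_ne_zero]
  exact Finset.prod_ne_zero_iff.2 fun i _ => h i

lemma LowerTri.isUnit_of_diag_ne_zero (hA : LowerTri A) (h : ∀ i, A i i ≠ 0) : IsUnit A := by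
  rw [isUnit_iff_isUnit_det, det_of_isLowerTriangular _ hA.isLowerTriangular, isUnit_iff_ne_zero]
  exact Finset.prod_ne_zero_iff.2 fun i _ => h i

lemma Nplus_subset_Bplus : Nplus k ⊆ Bplus k :=
  fun _ h => ⟨h.1.isUnit_of_diag_ne_zero fun i => by simp [h.2 i], h.1⟩

lemma Nminus_subset_Bminus : Nminus k ⊆ Bminus k :=
  fun _ h => ⟨h.1.isUnit_of_diag_ne_zero fun i => by simp [h.2 i], h.1⟩

lemma mul_inv_of_isUnit (hA : IsUnit A) : A * A⁻¹ = 1 :=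
  mul_nonsing_inv _ ((isUnit_iff_isUnit_det _).1 hA)

lemma inv_mul_of_isUnit (hA : IsUnit A) : A⁻¹ * A = 1 :=
  nonsing_inv_mul _ ((isUnit_iff_isUnit_det _).1 hA)

lemma UpperTri.conj_apply_self {c : Matrix (Fin k) (Fin k) ℂ} (hc : c ∈ Bplus k)
    (hA : UpperTri A) (i : Fin k) : (c * A * c⁻¹) i i = A i i := by
  have h : (c * c⁻¹) i i = 1 := by rw [mul_inv_of_isUnit hc.1, one_apply_eq]
  rw [hc.2.mul_apply_self hc.2.inv] at h
  rw [(hc.2.mul hA).mul_apply_self hc.2.inv, hc.2.mul_apply_self hA]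
  linear_combination A i i * h

lemma LowerTri.conj_apply_self {b : Matrix (Fin k) (Fin k) ℂ} (hb : b ∈ Bminus k)
    (hA : LowerTri A) (i : Fin k) : (b * A * b⁻¹) i i = A i i := by
  have h : (b * b⁻¹) i i = 1 := by rw [mul_inv_of_isUnit hb.1, one_apply_eq]
  rw [hb.2.mul_apply_self hb.2.inv] at h
  rw [(hb.2.mul hA).mul_apply_self hb.2.inv, hb.2.mul_apply_self hA]
  linear_combination A i i * h

lemma mul_mem_Bplus (hA : A ∈ Bplus k) (hB : B ∈ Bplus k) : A * B ∈ Bplus k :=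
  ⟨hA.1.mul hB.1, hA.2.mul hB.2⟩

lemma mul_mem_Bminus (hA : A ∈ Bminus k) (hB : B ∈ Bminus k) : A * B ∈ Bminus k :=
  ⟨hA.1.mul hB.1, hA.2.mul hB.2⟩

lemma inv_mem_Bplus (hA : A ∈ Bplus k) : A⁻¹ ∈ Bplus k :=
  ⟨isUnit_nonsing_inv_iff.2 hA.1, hA.2.inv⟩

lemma inv_mem_Bminus (hA : A ∈ Bminus k) : A⁻¹ ∈ Bminus k :=
  ⟨isUnit_nonsing_inv_iff.2 hA.1, hA.2.inv⟩

/-- Evaluating a polynomial at an upper triangular matrix gives an upper triangular matrix, with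
diagonal obtained by evaluating the polynomial at the diagonal entries. -/
lemma UpperTri.aeval (hA : UpperTri A) (p : Polynomial ℂ) :
    UpperTri (Polynomial.aeval A p) ∧ ∀ i, Polynomial.aeval A p i i = p.eval (A i i) := by
  have hpow : ∀ r : ℕ, UpperTri (A ^ r) ∧ ∀ i, (A ^ r) i i = A i i ^ r := by
    intro r
    induction r with
    | zero => exact ⟨by simpa using upperTri_one, by simp⟩
    | succ r ih =>
      rw [pow_succ]
      exact ⟨ih.1.mul hA, fun i => by rw [ih.1.mul_apply_self hA, ih.2, pow_succ]⟩
  induction p using Polynomial.induction_on' with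
  | add p q hp hq =>
    rw [map_add]
    exact ⟨hp.1.add hq.1, fun i => by simp [hp.2, hq.2]⟩
  | monomial r a =>
    rw [Polynomial.aeval_monomial, ← Algebra.smul_def]
    exact ⟨(hpow r).1.smul a, fun i => by simp [(hpow r).2]⟩

/-- An upper triangular matrix killed by a polynomial with simple roots is conjugate under the
unipotent upper triangular group to its diagonal. -/
lemma UpperTri.exists_diagonalization (hA : UpperTri A) (S : Finset ℂ)
    (hS : Polynomial.aeval A (∏ a ∈ S, (Polynomial.X - Polynomial.C a)) = 0) :
    ∃ c ∈ Nplus k, A * c = c * diagonal fun i => A i i := by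
  have hmem : ∀ i, A i i ∈ S := fun i => by
    have := (hA.aeval (∏ a ∈ S, (Polynomial.X - Polynomial.C a))).2 i
    rw [hS, Polynomial.eval_prod] at this
    obtain ⟨a, ha, h⟩ := Finset.prod_eq_zero_iff.1 this.symm
    simp only [Polynomial.eval_sub, Polynomial.eval_X, Polynomial.eval_C, sub_eq_zero] at h
    exact h ▸ ha
  set q : Fin k → Polynomial ℂ :=
    fun j => ∏ a ∈ S.erase (A j j), (Polynomial.X - Polynomial.C a) with hq
  have hq0 : ∀ j, (q j).eval (A j j) ≠ 0 := fun j => by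
    rw [hq, Polynomial.eval_prod]
    refine Finset.prod_ne_zero_iff.2 fun a ha => ?_
    simpa [sub_eq_zero] using (Finset.ne_of_mem_erase ha).symm
  have hann : ∀ j, A * Polynomial.aeval A (q j) = A j j • Polynomial.aeval A (q j) := fun j => by
    rw [← Finset.mul_prod_erase S _ (hmem j), map_mul] at hS
    simp only [map_sub, Polynomial.aeval_X, Polynomial.aeval_C, sub_mul, sub_eq_zero] at hS
    rw [hq, hS, Algebra.smul_def]
  refine ⟨of fun i j => Polynomial.aeval A (q j) i j / (q j).eval (A j j), ⟨?_, ?_⟩, ?_⟩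
  · intro i j hij
    simp [(hA.aeval (q j)).1 i j hij]
  · intro j
    simp [(hA.aeval (q j)).2 j, hq0 j]
  · ext i j
    have := congrFun (congrFun (hann j) i) j
    rw [Matrix.mul_apply] at this
    rw [mul_diagonal, Matrix.mul_apply]
    simp only [of_apply, ← mul_div_assoc, ← Finset.sum_div, this, Matrix.smul_apply,
      smul_eq_mul]
    ring

lemma LowerTri.exists_diagonalization (hA : LowerTri A) (S : Finset ℂ)
    (hS : Polynomial.aeval A (∏ a ∈ S, (Polynomial.X - Polynomial.C a)) = 0) :
    ∃ b ∈ Nminus k, A * b = b * diagonal fun i => A i i := by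
  have htr : ∀ p : Polynomial ℂ, Polynomial.aeval Aᵀ p = (Polynomial.aeval A p)ᵀ := fun p => by
    induction p using Polynomial.induction_on' with
    | add p q hp hq => rw [map_add, map_add, hp, hq, transpose_add]
    | monomial r a =>
      rw [Polynomial.aeval_monomial, Polynomial.aeval_monomial, ← Algebra.smul_def,
        ← Algebra.smul_def, transpose_smul, transpose_pow]
  obtain ⟨c, hc, h⟩ := (lowerTri_iff_transpose.1 hA).exists_diagonalization S
    (by rw [htr, hS, transpose_zero])
  have hu := (Nplus_subset_Bplus hc).1
  have hct : IsUnit cᵀ := (isUnit_transpose _).2 hu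
  have hlow : LowerTri cᵀ := upperTri_iff_transpose.1 hc.1
  refine ⟨(cᵀ)⁻¹, ⟨hlow.inv, fun i => ?_⟩, ?_⟩
  · have h1 : (cᵀ * (cᵀ)⁻¹) i i = 1 := by rw [mul_inv_of_isUnit hct, one_apply_eq]
    rw [hlow.mul_apply_self hlow.inv] at h1
    simpa [hc.2 i] using h1
  · have h1 : cᵀ * A = (diagonal fun i => A i i) * cᵀ := by
      simpa using congrArg transpose h
    calc A * (cᵀ)⁻¹ = (cᵀ)⁻¹ * (cᵀ * A) * (cᵀ)⁻¹ := by
          rw [← Matrix.mul_assoc, inv_mul_of_isUnit hct, Matrix.one_mul]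
      _ = _ := by
          rw [h1, Matrix.mul_assoc, Matrix.mul_assoc, mul_inv_of_isUnit hct, Matrix.mul_one]

end Triangular

section GeneralizedInverse

variable {m n : ℕ}

/-- Every matrix can be reduced, under lower triangular row operations and upper triangular column
operations, to a matrix with at most one nonzero entry in each row and column. -/
lemma exists_monomial_reduction (X : Matrix (Fin m) (Fin n) ℂ) :
    ∃ b ∈ Bminus m, ∃ c ∈ Bplus n,
      ∀ i j, (b * X * c) i j ≠ 0 →
        (∀ i', (b * X * c) i' j ≠ 0 → i' = i) ∧ (∀ j', (b * X * c) i j' ≠ 0 → j' = j) := by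
  suffices H : ∀ r ≤ m, ∃ b ∈ Bminus m, ∃ c ∈ Bplus n, ∀ i : Fin m, i.val < r → ∀ j,
      (b * X * c) i j ≠ 0 →
        (∀ i', (b * X * c) i' j ≠ 0 → i' = i) ∧ (∀ j', (b * X * c) i j' ≠ 0 → j' = j) by
    obtain ⟨b, hb, c, hc, h⟩ := H m le_rfl
    exact ⟨b, hb, c, hc, fun i => h i i.2⟩
  intro r
  induction r with
  | zero =>
    exact fun _ => ⟨1, ⟨isUnit_one, lowerTri_one⟩, 1, ⟨isUnit_one, upperTri_one⟩,
      fun i hi => absurd hi (Nat.not_lt_zero _)⟩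
  | succ r ih =>
    intro hr
    obtain ⟨b, hb, c, hc, h⟩ := ih (Nat.le_of_succ_le hr)
    set W := b * X * c with hW
    let k : Fin m := ⟨r, hr⟩
    by_cases hk : ∀ j, W k j = 0
    · refine ⟨b, hb, c, hc, fun i hi j hij => ?_⟩
      rcases Nat.lt_succ_iff_lt_or_eq.1 hi with hi' | hi'
      · exact h i hi' j hij
      · exact absurd (hk j) (by rwa [show k = i from Fin.ext hi'.symm])
    push Not at hk
    obtain ⟨j₀, hj₀, hmin⟩ : ∃ j₀, W k j₀ ≠ 0 ∧ ∀ j < j₀, W k j = 0 := by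
      obtain ⟨j₀, h1, h2⟩ := wellFounded_lt.has_min {j | W k j ≠ 0} hk
      exact ⟨j₀, h1, fun j hj => by_contra fun h3 => h2 j h3 hj⟩
    let u : Fin m → ℂ := fun i => if i = k then 0 else W i j₀ / W k j₀
    let v : Fin n → ℂ := fun j => if j = j₀ then 0 else W k j / W k j₀
    have hcol : ∀ i : Fin m, i.val < r → W i j₀ = 0 := fun i hi => by
      by_contra h0
      have := (h i hi j₀ h0).1 k hj₀
      exact hi.ne (congrArg Fin.val this.symm)
    let b₁ : Matrix (Fin m) (Fin m) ℂ := 1 - vecMulVec u (Pi.single k 1)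
    let c₁ : Matrix (Fin n) (Fin n) ℂ := 1 - vecMulVec (Pi.single j₀ 1) v
    have hb₁ : b₁ ∈ Bminus m := by
      refine Nminus_subset_Bminus ⟨fun i j hij => ?_, fun i => ?_⟩
      · rcases eq_or_ne j k with rfl | hjk
        · simp [b₁, vecMulVec_apply, u, hij.ne, hcol i hij]
        · simp [b₁, vecMulVec_apply, hij.ne, hjk]
      · rcases eq_or_ne i k with rfl | hjk
        · simp [b₁, vecMulVec_apply, u]
        · simp [b₁, vecMulVec_apply, hjk]
    have hc₁ : c₁ ∈ Bplus n := by
      refine Nplus_subset_Bplus ⟨fun i j hij => ?_, fun i => ?_⟩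
      · rcases eq_or_ne i j₀ with rfl | hjk
        · simp [c₁, vecMulVec_apply, v, hij.ne', hmin j hij]
        · simp [c₁, vecMulVec_apply, hij.ne', hjk]
      · rcases eq_or_ne i j₀ with rfl | hjk
        · simp [c₁, vecMulVec_apply, v]
        · simp [c₁, vecMulVec_apply, hjk]
    have hexp : ∀ i j, (b₁ * W * c₁) i j
        = W i j - u i * W k j - W i j₀ * v j + u i * W k j₀ * v j := fun i j => by
      simp only [b₁, c₁, Matrix.sub_mul, Matrix.mul_sub, Matrix.one_mul, Matrix.mul_one,
        vecMulVec_mul, mul_vecMulVec, Matrix.sub_apply, vecMulVec_apply, single_one_vecMul,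
        mulVec_single_one, Matrix.row, Matrix.col_apply]
      ring
    have hne : ∀ i j, i ≠ k →
        (b₁ * W * c₁) i j = W i j - W i j₀ * W k j / W k j₀ := fun i j hi => by
      rw [hexp]
      simp only [u, if_neg hi]
      field_simp
      ring
    have heq : ∀ j, (b₁ * W * c₁) k j = if j = j₀ then W k j₀ else 0 := fun j => by
      rw [hexp]
      simp only [u, v, if_true]
      split_ifs with hj
      · simp [hj]
      · field_simp
        ring
    refine ⟨b₁ * b, mul_mem_Bminus hb₁ hb, c * c₁, mul_mem_Bplus hc hc₁, ?_⟩
    rw [show b₁ * b * X * (c * c₁) = b₁ * W * c₁ by simp only [hW, Matrix.mul_assoc]]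
    intro i hi j hij
    rcases Nat.lt_succ_iff_lt_or_eq.1 hi with hi' | hi'
    · have hik : i ≠ k := fun h0 => hi'.ne (congrArg Fin.val h0)
      have hrow : ∀ j, (b₁ * W * c₁) i j = W i j := fun j => by
        rw [hne i j hik, hcol i hi']; simp
      rw [hrow] at hij
      refine ⟨fun i' hi'' => ?_, fun j' hj' => (h i hi' j hij).2 j' (by rwa [← hrow])⟩
      have hkj : W k j = 0 := by
        by_contra h0
        exact hik ((h i hi' j hij).1 k h0).symm
      rcases eq_or_ne i' k with rfl | hi'k
      · rw [heq] at hi''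
        split_ifs at hi'' with hj
        · exact absurd (hcol i hi') (hj ▸ hij)
        · exact absurd rfl hi''
      · rw [hne i' j hi'k, hkj] at hi''
        exact (h i hi' j hij).1 i' (by simpa using hi'')
    · obtain rfl : i = k := Fin.ext hi'
      have hj : j = j₀ := by
        by_contra h0
        exact hij (by rw [heq, if_neg h0])
      subst hj
      refine ⟨fun i' hi'' => ?_, fun j' hj' => ?_⟩
      · by_contra h0
        refine hi'' ?_
        rw [hne i' _ h0]
        field_simp
        ring
      · by_contra h0
        exact hj' (by rw [heq, if_neg h0])

/-- A matrix has generalized inverses compatible with the lower-upper conditions; there is one with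
`X * Z` of prescribed diagonal, up to a factor `δ` independent of the prescription. -/
lemma exists_triangular_inverse_family (X : Matrix (Fin m) (Fin n) ℂ) :
    ∃ δ : Fin m → ℂ, ∀ d : Fin m → ℂ, ∃ Z : Matrix (Fin n) (Fin m) ℂ,
      LowerTri (X * Z) ∧ UpperTri (Z * X) ∧ (∀ i, (X * Z) i i = d i * δ i) ∧
        (d = 1 → X * Z * X = X) := by
  obtain ⟨b, hb, c, hc, h⟩ := exists_monomial_reduction X
  set W := b * X * c with hW
  let V : (Fin m → ℂ) → Matrix (Fin n) (Fin m) ℂ := fun d => of fun j i => d i * (W i j)⁻¹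
  let δ : Fin m → ℂ := fun i => ∑ j, W i j * (W i j)⁻¹
  have hWV : ∀ d, W * V d = diagonal fun i => d i * δ i := fun d => by
    ext i i'
    rw [Matrix.mul_apply]
    rcases eq_or_ne i i' with rfl | hii
    · rw [diagonal_apply_eq, Finset.mul_sum]
      exact Finset.sum_congr rfl fun j _ => by simp only [V, of_apply]; ring
    · rw [diagonal_apply_ne _ hii]
      refine Finset.sum_eq_zero fun j _ => ?_
      by_cases h1 : W i j = 0
      · simp [h1]
      · have : W i' j = 0 := by
          by_contra h2
          exact hii ((h i j h1).1 i' h2).symm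
        simp [V, this]
  have hVW : ∀ d, ∃ e, V d * W = diagonal e := fun d => by
    refine ⟨fun j => (V d * W) j j, ?_⟩
    ext j j'
    rcases eq_or_ne j j' with rfl | hjj
    · rw [diagonal_apply_eq]
    · rw [diagonal_apply_ne _ hjj, Matrix.mul_apply]
      refine Finset.sum_eq_zero fun i _ => ?_
      by_cases h1 : W i j = 0
      · simp [V, h1]
      · have : W i j' = 0 := by
          by_contra h2
          exact hjj ((h i j h1).2 j' h2).symm
        simp [this]
  have hX : X = b⁻¹ * W * c⁻¹ := by
    rw [hW, Matrix.mul_assoc b, ← Matrix.mul_assoc, ← Matrix.mul_assoc, inv_mul_of_isUnit hb.1,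
      Matrix.one_mul, Matrix.mul_assoc, mul_inv_of_isUnit hc.1, Matrix.mul_one]
  have hXZ : ∀ d, X * (c * V d * b) = b⁻¹ * (W * V d) * b⁻¹⁻¹ := fun d => by
    rw [nonsing_inv_nonsing_inv _ ((isUnit_iff_isUnit_det _).1 hb.1)]
    calc X * (c * V d * b) = b⁻¹ * W * (c⁻¹ * c) * V d * b := by
          rw [hX]; simp only [Matrix.mul_assoc]
      _ = _ := by rw [inv_mul_of_isUnit hc.1, Matrix.mul_one]; simp only [Matrix.mul_assoc]
  refine ⟨δ, fun d => ⟨c * V d * b, ?_, ?_, fun i => ?_, ?_⟩⟩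
  · rw [hXZ, hWV]
    exact (hb.2.inv.mul (lowerTri_diagonal _)).mul hb.2.inv.inv
  · obtain ⟨e, he⟩ := hVW d
    have : c * V d * b * X = c * (V d * W) * c⁻¹ := by
      calc c * V d * b * X = c * V d * (b * b⁻¹) * W * c⁻¹ := by
            conv_lhs => rw [hX]
            simp only [Matrix.mul_assoc]
        _ = _ := by rw [mul_inv_of_isUnit hb.1, Matrix.mul_one]; simp only [Matrix.mul_assoc]
    rw [this, he]
    exact (hc.2.mul (upperTri_diagonal _)).mul hc.2.inv
  · rw [hXZ, hWV, LowerTri.conj_apply_self (inv_mem_Bminus hb) (lowerTri_diagonal _), diagonal_apply_eq]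
  · rintro rfl
    have hWVW : W * V 1 * W = W := by
      ext i j
      rw [hWV, diagonal_mul]
      by_cases h1 : W i j = 0
      · simp [h1]
      · have : δ i = 1 := by
          refine (Finset.sum_eq_single j (fun j' _ hj' => ?_) (by simp)).trans
            (mul_inv_cancel₀ h1)
          have : W i j' = 0 := by
            by_contra h2
            exact hj' ((h i j h1).2 j' h2)
          simp [this]
        simp [this]
    rw [hXZ, nonsing_inv_nonsing_inv _ ((isUnit_iff_isUnit_det _).1 hb.1)]
    calc b⁻¹ * (W * V 1) * b * X = b⁻¹ * (W * V 1) * (b * b⁻¹) * W * c⁻¹ := by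
          conv_lhs => rw [hX]
          simp only [Matrix.mul_assoc]
      _ = b⁻¹ * (W * V 1 * W) * c⁻¹ := by
          rw [mul_inv_of_isUnit hb.1, Matrix.mul_one]; simp only [Matrix.mul_assoc]
      _ = X := by rw [hWVW, ← hX]

lemma exists_triangular_inverse (X : Matrix (Fin m) (Fin n) ℂ) :
    ∃ Z : Matrix (Fin n) (Fin m) ℂ, LowerTri (X * Z) ∧ UpperTri (Z * X) ∧ X * Z * X = X := by
  obtain ⟨δ, h⟩ := exists_triangular_inverse_family X
  obtain ⟨Z, h1, h2, -, h3⟩ := h 1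
  exact ⟨Z, h1, h2, h3 rfl⟩

lemma exists_triangular_inverse' (Y : Matrix (Fin n) (Fin m) ℂ) :
    ∃ Z : Matrix (Fin m) (Fin n) ℂ, LowerTri (Z * Y) ∧ UpperTri (Y * Z) ∧ Y * Z * Y = Y := by
  obtain ⟨Z, h1, h2, h3⟩ := exists_triangular_inverse (Y.submatrix Fin.rev Fin.rev)ᵀ
  have hmul : ∀ {p q r : ℕ} (A : Matrix (Fin p) (Fin q) ℂ) (B : Matrix (Fin q) (Fin r) ℂ),
      A.submatrix Fin.rev Fin.rev * B.submatrix Fin.rev Fin.rev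
        = (A * B).submatrix Fin.rev Fin.rev :=
    fun A B => submatrix_mul_equiv A B Fin.rev Fin.revPerm Fin.rev
  obtain ⟨Z, rfl⟩ : ∃ Z' : Matrix (Fin m) (Fin n) ℂ, Z = (Z'.submatrix Fin.rev Fin.rev)ᵀ :=
    ⟨(Z.submatrix Fin.rev Fin.rev)ᵀ, by ext; simp⟩
  rw [← transpose_mul, hmul] at h1 h2
  refine ⟨Z, fun i j hij => ?_, fun i j hij => ?_, ?_⟩
  · simpa using h1 j.rev i.rev (Fin.rev_lt_rev.2 hij)
  · simpa using h2 j.rev i.rev (Fin.rev_lt_rev.2 hij)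
  · rw [← transpose_mul, ← transpose_mul, hmul, hmul] at h3
    ext i j
    simpa [Matrix.mul_assoc] using congrFun (congrFun h3 j.rev) i.rev

end GeneralizedInverse

section Closure

variable {m n : ℕ}

lemma subset_zclosure (S : Set (LUSpace m n)) : S ⊆ zclosure S := fun _ hp _ hf => hf _ hp

lemma zclosure_subset_zclosure {S T : Set (LUSpace m n)} (h : S ⊆ zclosure T) :
    zclosure S ⊆ zclosure T :=
  fun _ hp f hf => hp f fun _ hq => h hq f hf

/-- Zariski closures are stable under limits along lines. -/
lemma mem_zclosure_of_line {S : Set (LUSpace m n)} (p q : LUSpace m n)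
    (h : ∀ᶠ ε : ℂ in Filter.cofinite, p + ε • q ∈ zclosure S) : p ∈ zclosure S := by
  intro f hf
  let g : Polynomial ℂ := MvPolynomial.aeval
    (fun i => Polynomial.C (coordsOf p i) + Polynomial.X * Polynomial.C (coordsOf q i)) f
  have hg : ∀ ε, g.eval ε = MvPolynomial.eval (coordsOf (p + ε • q)) f := fun ε => by
    have hcoord : coordsOf (p + ε • q) = fun i => coordsOf p i + ε * coordsOf q i := by
      ext i
      rcases i with i | i <;> simp [coordsOf]
    rw [hcoord]
    simp only [g, ← Polynomial.coe_evalRingHom, MvPolynomial.aeval_def,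
      MvPolynomial.hom_eval₂, MvPolynomial.eval, MvPolynomial.coe_eval₂Hom]
    congr 1
    · ext x
      simp
    · ext i
      simp
      ring
  have hg0 : g = 0 := by
    refine Polynomial.eq_zero_of_infinite_isRoot _ ?_
    refine Set.Infinite.mono (s := {ε : ℂ | p + ε • q ∈ zclosure S}) (fun ε hε => ?_) ?_
    · exact (hg ε).trans (hε f hf)
    · intro hfin
      have := h.and hfin.compl_mem_cofinite
      obtain ⟨ε, h1, h2⟩ := this.exists
      exact h2 h1
  simpa [hg0] using (hg 0).symm

lemma zclosure_iUnion {ι : Type*} [Fintype ι] (S : ι → Set (LUSpace m n)) :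
    zclosure (⋃ i, S i) ⊆ ⋃ i, zclosure (S i) := by
  intro p hp
  by_contra h
  simp only [Set.mem_iUnion, not_exists, zclosure, Set.mem_ofPred_eq, not_forall] at h
  choose f hf hfp using h
  refine Finset.prod_ne_zero_iff.2 (fun i _ => hfp i)
    ((map_prod (MvPolynomial.eval (coordsOf p)) f Finset.univ).symm.trans (hp _ fun q hq => ?_))
  obtain ⟨i, hi⟩ := Set.mem_iUnion.1 hq
  rw [map_prod]
  exact Finset.prod_eq_zero (Finset.mem_univ i) (hf i q hi)

lemma zclosure_LU : zclosure (LU m n) ⊆ LU m n := by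
  intro p hp
  refine ⟨fun i j hij => ?_, fun i j hij => ?_⟩
  · have := hp (∑ k, MvPolynomial.X (.inl (i, k)) * MvPolynomial.X (.inr (k, j)))
      fun q hq => by simpa [coordsOf, Matrix.mul_apply] using hq.1 i j hij
    simpa [coordsOf, Matrix.mul_apply] using this
  · have := hp (∑ k, MvPolynomial.X (.inr (i, k)) * MvPolynomial.X (.inl (k, j)))
      fun q hq => by simpa [coordsOf, Matrix.mul_apply] using hq.2 i j hij
    simpa [coordsOf, Matrix.mul_apply] using this

/-- Only finitely many `ε` satisfy a nontrivial affine equation. -/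
lemma eventually_affine_ne_zero (a b : ℂ) (h : b ≠ 0) :
    ∀ᶠ ε : ℂ in Filter.cofinite, a + ε * b ≠ 0 := by
  refine (Set.finite_singleton (-a / b)).subset fun ε hε => ?_
  simp only [Set.mem_compl_iff, Set.mem_ofPred_eq, not_not] at hε
  rw [Set.mem_singleton_iff, eq_div_iff h]
  linear_combination hε

lemma eventually_isUnit_det_add_smul_one {k : ℕ} (A : Matrix (Fin k) (Fin k) ℂ) :
    ∀ᶠ ε : ℂ in Filter.cofinite, IsUnit (A + ε • (1 : Matrix (Fin k) (Fin k) ℂ)).det := by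
  have hfin : {x : ℂ | (-A).charpoly.IsRoot x}.Finite := by
    refine Set.not_infinite.1 fun hinf => ?_
    exact (charpoly_monic (-A)).ne_zero (Polynomial.eq_zero_of_infinite_isRoot _ hinf)
  refine hfin.subset fun ε hε => ?_
  simp only [Set.mem_compl_iff, Set.mem_ofPred_eq, isUnit_iff_ne_zero, not_not] at hε
  rw [Set.mem_ofPred_eq, Polynomial.IsRoot, eval_charpoly, ← hε]
  congr 1
  rw [sub_neg_eq_add, add_comm, smul_one_eq_diagonal]
  rfl

lemma rank_mul_eq_of_generalized_inverse {p q : ℕ} {X : Matrix (Fin p) (Fin q) ℂ}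
    {Z : Matrix (Fin q) (Fin p) ℂ} (hZ : X * Z * X = X) :
    (X * Z).rank = X.rank ∧ (Z * X).rank = X.rank := by
  refine ⟨le_antisymm (rank_mul_le_left _ _) ?_, le_antisymm (rank_mul_le_right _ _) ?_⟩
  · conv_lhs => rw [← hZ]
    exact rank_mul_le_left _ _
  · conv_lhs => rw [← hZ, Matrix.mul_assoc]
    exact rank_mul_le_right _ _

/-- Perturbing `Y` in the direction of a generalized inverse of `X` makes the two products with `X`
have the same rank as `X`. -/
lemma eventually_rank_mul_eq {p q : ℕ} {X : Matrix (Fin p) (Fin q) ℂ}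
    (Y : Matrix (Fin q) (Fin p) ℂ) {Z : Matrix (Fin q) (Fin p) ℂ} (hZ : X * Z * X = X) :
    ∀ᶠ ε : ℂ in Filter.cofinite,
      (X * (Y + ε • Z)).rank = X.rank ∧ ((Y + ε • Z) * X).rank = X.rank := by
  filter_upwards [eventually_isUnit_det_add_smul_one (X * Y),
    eventually_isUnit_det_add_smul_one (Y * X)] with ε h1 h2
  have e1 : X * (Y + ε • Z) = X * Z * (X * Y + ε • 1) := by
    rw [Matrix.mul_add, Matrix.mul_add, ← Matrix.mul_assoc (X * Z), hZ]
    simp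
  have e2 : (Y + ε • Z) * X = (Y * X + ε • 1) * (Z * X) := by
    rw [Matrix.add_mul, Matrix.add_mul, Matrix.mul_assoc Y, ← Matrix.mul_assoc X, hZ]
    simp
  rw [e1, e2, rank_mul_eq_left_of_isUnit_det _ _ h1, rank_mul_eq_right_of_isUnit_det _ _ h2]
  exact rank_mul_eq_of_generalized_inverse hZ

lemma exists_mulVec_eq_zero_of_rank_lt {p q : ℕ} (Y : Matrix (Fin p) (Fin q) ℂ) (h : Y.rank < q) :
    ∃ u ≠ 0, Y *ᵥ u = 0 := by
  by_contra! hne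
  have hinj : LinearMap.ker Y.mulVecLin = ⊥ := by
    refine LinearMap.ker_eq_bot'.2 fun u hu => ?_
    by_contra h0
    exact hne u h0 hu
  have := LinearMap.finrank_range_of_inj (LinearMap.ker_eq_bot.1 hinj)
  rw [Module.finrank_fin_fun] at this
  exact h.ne this

lemma mulVec_eq_zero_of_rank_mul_eq {p q r : ℕ} {Y : Matrix (Fin p) (Fin q) ℂ}
    {X : Matrix (Fin q) (Fin r) ℂ} (h : (Y * X).rank = X.rank) (v : Fin r → ℂ)
    (hv : (Y * X) *ᵥ v = 0) : X *ᵥ v = 0 := by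
  have hle : LinearMap.ker X.mulVecLin ≤ LinearMap.ker (Y * X).mulVecLin := fun w hw => by
    have : X *ᵥ w = 0 := hw
    simp [this]
  have h1 := LinearMap.finrank_range_add_finrank_ker X.mulVecLin
  have h2 := LinearMap.finrank_range_add_finrank_ker (Y * X).mulVecLin
  change X.rank + _ = _ at h1
  change (Y * X).rank + _ = _ at h2
  have heq := Submodule.eq_of_le_of_finrank_eq hle (by lia)
  have : v ∈ LinearMap.ker X.mulVecLin := heq ▸ hv
  exact this

/-- If `X`, `Y` and both products have the same non-maximal rank, then `X` can be perturbed without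
changing the products so that its rank increases. -/
lemma exists_rank_lt_of_rank_eq {X : Matrix (Fin m) (Fin n) ℂ} {Y : Matrix (Fin n) (Fin m) ℂ}
    (h1 : (X * Y).rank = X.rank) (h2 : (Y * X).rank = X.rank) (hYm : Y.rank < m)
    (hYn : Y.rank < n) :
    ∃ Z : Matrix (Fin m) (Fin n) ℂ, Z * Y = 0 ∧ Y * Z = 0 ∧
      ∀ ε : ℂ, ε ≠ 0 → X.rank < (X + ε • Z).rank := by
  obtain ⟨u, hu0, hu⟩ := exists_mulVec_eq_zero_of_rank_lt Y hYm
  obtain ⟨φ, hφ0, hφ⟩ := exists_mulVec_eq_zero_of_rank_lt Yᵀ (by rwa [rank_transpose])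
  rw [mulVec_transpose] at hφ
  have hZY : vecMulVec u φ * Y = 0 := by rw [vecMulVec_mul, hφ, vecMulVec_zero]
  refine ⟨vecMulVec u φ, hZY, by rw [mul_vecMulVec, hu, zero_vecMulVec], fun ε hε => ?_⟩
  set X' := X + ε • vecMulVec u φ with hX'
  have hXY : X' * Y = X * Y := by
    rw [hX', Matrix.add_mul, Matrix.smul_mul, hZY, smul_zero, add_zero]
  have hrange : LinearMap.range (X * Y).mulVecLin = LinearMap.range X.mulVecLin := by
    refine Submodule.eq_of_le_of_finrank_eq ?_ h1
    rw [mulVecLin_mul]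
    exact LinearMap.range_comp_le_range _ _
  have hle : LinearMap.range X.mulVecLin ≤ LinearMap.range X'.mulVecLin := by
    rw [← hrange, ← hXY, mulVecLin_mul]
    exact LinearMap.range_comp_le_range _ _
  obtain ⟨j, hj⟩ := Function.ne_iff.1 hφ0
  have hmem : u ∈ LinearMap.range X'.mulVecLin := by
    have e : X' *ᵥ Pi.single j 1 = X *ᵥ Pi.single j 1 + (ε * φ j) • u := by
      rw [hX', add_mulVec, smul_mulVec, vecMulVec_mulVec]
      ext i
      simp
      ring
    have h3 : (ε * φ j) • u ∈ LinearMap.range X'.mulVecLin := by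
      rw [← add_sub_cancel_left (X *ᵥ Pi.single j 1) ((ε * φ j) • u), ← e]
      exact Submodule.sub_mem _ ⟨_, rfl⟩ (hle ⟨_, rfl⟩)
    exact (Submodule.smul_mem_iff _ (mul_ne_zero hε hj)).1 h3
  refine Submodule.finrank_lt_finrank_of_lt (lt_of_le_of_ne hle fun heq => ?_)
  rw [← heq] at hmem
  obtain ⟨v, hv⟩ := hmem
  refine hu0 ?_
  rw [← hv]
  refine mulVec_eq_zero_of_rank_mul_eq h2 v ?_
  rw [← mulVec_mulVec]
  exact (congrArg (Y *ᵥ ·) hv).trans hu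

lemma LU_add_smul_right {X : Matrix (Fin m) (Fin n) ℂ} {Y Z : Matrix (Fin n) (Fin m) ℂ}
    (h : (X, Y) ∈ LU m n) (h1 : LowerTri (X * Z)) (h2 : UpperTri (Z * X)) (ε : ℂ) :
    (X, Y + ε • Z) ∈ LU m n := by
  constructor
  · simpa [Matrix.mul_add] using h.1.add (h1.smul ε)
  · simpa [Matrix.add_mul] using h.2.add (h2.smul ε)

lemma LU_add_smul_left {X Z : Matrix (Fin m) (Fin n) ℂ} {Y : Matrix (Fin n) (Fin m) ℂ}
    (h : (X, Y) ∈ LU m n) (h1 : LowerTri (Z * Y)) (h2 : UpperTri (Y * Z)) (ε : ℂ) :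
    (X + ε • Z, Y) ∈ LU m n := by
  constructor
  · simpa [Matrix.add_mul] using h.1.add (h1.smul ε)
  · simpa [Matrix.mul_add] using h.2.add (h2.smul ε)

/-- The points of the lower-upper scheme where `XY` has distinct nonzero diagonal entries. -/
def LUreg (m n : ℕ) : Set (LUSpace m n) :=
  { p | p ∈ LU m n ∧ (∀ i, (p.1 * p.2) i i ≠ 0) ∧
    ∀ i i' : Fin m, i ≠ i' → (p.1 * p.2) i i ≠ (p.1 * p.2) i' i' }

/-- Along a line, diagonal entries moving with distinct nonzero speeds are generically distinct and
nonzero. -/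
lemma eventually_distinct_nonzero (a : Fin m → ℂ) :
    ∀ᶠ ε : ℂ in Filter.cofinite, (∀ i : Fin m, a i + ε * (i.val + 1 : ℂ) ≠ 0) ∧
      ∀ i i' : Fin m, i ≠ i' → a i + ε * (i.val + 1 : ℂ) ≠ a i' + ε * (i'.val + 1 : ℂ) := by
  refine (Filter.eventually_all.2 fun i => eventually_affine_ne_zero _ _ ?_).and
    (Filter.eventually_all.2 fun i => Filter.eventually_all.2 fun i' => ?_)
  · exact Nat.cast_add_one_ne_zero i.val
  · by_cases hii : i = i'
    · exact Filter.Eventually.of_forall fun _ h => absurd hii h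
    · have : (i.val : ℂ) - i'.val ≠ 0 := by
        rw [sub_ne_zero]
        exact_mod_cast fun h => hii (Fin.ext h)
      filter_upwards [eventually_affine_ne_zero (a i - a i') _ this] with ε hε _ h
      exact hε (by linear_combination h)

lemma mem_zclosure_LUreg_of_rank_eq {X : Matrix (Fin m) (Fin n) ℂ} {Y : Matrix (Fin n) (Fin m) ℂ}
    (h : (X, Y) ∈ LU m n) (hX : X.rank = m) : (X, Y) ∈ zclosure (LUreg m n) := by
  obtain ⟨δ, hδ⟩ := exists_triangular_inverse_family X
  have hδ1 : ∀ i, δ i = 1 := fun i => by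
    obtain ⟨Z, -, -, h3, h4⟩ := hδ 1
    have h4 := h4 rfl
    have hr : (X * Z).rank = m := (rank_mul_eq_of_generalized_inverse h4).1.trans hX
    have hidem : X * Z * (X * Z) = X * Z := by rw [← Matrix.mul_assoc, h4]
    have hunit : IsUnit (X * Z) := by
      rw [← mulVec_surjective_iff_isUnit, ← coe_mulVecLin, ← LinearMap.range_eq_top]
      refine Submodule.eq_top_of_finrank_eq ?_
      rw [Module.finrank_fin_fun]
      exact hr
    have h1 : X * Z = 1 := hunit.mul_left_cancel (by rw [hidem, mul_one])
    simpa [h1] using (h3 i).symm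
  obtain ⟨Z, h1, h2, h3, -⟩ := hδ fun i => (i.val + 1 : ℂ)
  refine mem_zclosure_of_line _ (0, Z) ?_
  filter_upwards [eventually_distinct_nonzero fun i => (X * Y) i i] with ε hε
  refine subset_zclosure _ ?_
  have e : ((X, Y) : LUSpace m n) + ε • (0, Z) = (X, Y + ε • Z) := by simp
  have hdiag : ∀ i, (X * (Y + ε • Z)) i i = (X * Y) i i + ε * (i.val + 1 : ℂ) := fun i => by
    simp [Matrix.mul_add, h3, hδ1]
  rw [e]
  refine ⟨LU_add_smul_right h h1 h2 ε, fun i => ?_, fun i i' hii => ?_⟩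
  · simpa only [hdiag] using hε.1 i
  · simpa only [hdiag] using hε.2 i i' hii

lemma LU_subset_zclosure_LUreg (hmn : m ≤ n) : LU m n ⊆ zclosure (LUreg m n) := by
  suffices H : ∀ r, ∀ p ∈ LU m n, m - p.1.rank = r → p ∈ zclosure (LUreg m n) from
    fun p hp => H _ p hp rfl
  intro r
  induction r using Nat.strong_induction_on with
  | _ r ih =>
  rintro ⟨X, Y⟩ hp rfl
  have hXm : X.rank ≤ m := X.rank_le_height
  rcases hXm.eq_or_lt with hX | hX
  · exact mem_zclosure_LUreg_of_rank_eq hp hX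
  have key : ∀ Y' Z,
      (∀ᶠ ε : ℂ in Filter.cofinite,
        (X + ε • Z, Y') ∈ LU m n ∧ X.rank < (X + ε • Z).rank) →
      (X, Y') ∈ zclosure (LUreg m n) := fun Y' Z hZ => by
    refine mem_zclosure_of_line _ (Z, 0) ?_
    filter_upwards [hZ] with ε hε
    have e : ((X, Y') : LUSpace m n) + ε • (Z, 0) = (X + ε • Z, Y') := by simp
    rw [e]
    exact ih _ (Nat.sub_lt_sub_left hX hε.2) _ hε.1 rfl
  obtain ⟨Z, hZ1, hZ2, hZ3⟩ := exists_triangular_inverse X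
  refine mem_zclosure_of_line _ (0, Z) ?_
  filter_upwards [eventually_rank_mul_eq Y hZ3] with ε hε
  have e : ((X, Y) : LUSpace m n) + ε • (0, Z) = (X, Y + ε • Z) := by simp
  rw [e]
  have hmem := LU_add_smul_right hp hZ1 hZ2 ε
  generalize Y + ε • Z = Y' at hε hmem
  have hle : X.rank ≤ Y'.rank := hε.1 ▸ rank_mul_le_right _ _
  rcases hle.eq_or_lt with hr | hr
  · obtain ⟨Z', h1, h2, h3⟩ := exists_rank_lt_of_rank_eq hε.1 hε.2 (hr ▸ hX)
      (hr ▸ hX.trans_le hmn)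
    refine key Y' Z' ?_
    filter_upwards [(Set.finite_singleton (0 : ℂ)).compl_mem_cofinite] with η hη
    refine ⟨LU_add_smul_left hmem ?_ ?_ η, h3 η hη⟩
    · rw [h1]; exact fun _ _ _ => rfl
    · rw [h2]; exact fun _ _ _ => rfl
  · obtain ⟨Z', h1, h2, h3⟩ := exists_triangular_inverse' Y'
    refine key Y' Z' ?_
    filter_upwards [eventually_rank_mul_eq X h3] with η hη
    exact ⟨LU_add_smul_left hmem h1 h2 η, hr.trans_le (hη.1 ▸ rank_mul_le_right _ _)⟩

end Closure

section Components

variable {m n : ℕ}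

lemma permMat_mul_transpose (π : Fin m ↪ Fin n) : permMat π * (permMat π)ᵀ = 1 := by
  ext i i'
  simp [permMat, Matrix.mul_apply, Matrix.one_apply, eq_comm]

lemma transpose_permMat_mul_diagonal_mul (π : Fin m ↪ Fin n) (d : Fin m → ℂ) :
    (permMat π)ᵀ * diagonal d * permMat π = diagonal fun j => ∑ i, if π i = j then d i else 0 := by
  ext j j'
  rw [Matrix.mul_apply]
  simp only [mul_diagonal, transpose_apply, permMat, diagonal_apply]
  split_ifs with h
  · subst h
    exact Finset.sum_congr rfl fun i _ => by split_ifs <;> simp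
  · refine Finset.sum_eq_zero fun i _ => ?_
    by_cases h1 : π i = j
    · simp [h1, h]
    · simp [h1]

/-- The points of the lower-upper scheme with distinct nonzero diagonal entries of `XY`, matched
with diagonal entries of `YX` according to `π`. -/
def Fopen (π : Fin m ↪ Fin n) : Set (LUSpace m n) :=
  { p | p ∈ LU m n ∧ (∀ i : Fin m, (p.2 * p.1) (π i) (π i) = (p.1 * p.2) i i) ∧
    (∀ i : Fin m, (p.1 * p.2) i i ≠ 0) ∧
    ∀ i i' : Fin m, i ≠ i' → (p.1 * p.2) i i ≠ (p.1 * p.2) i' i' }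

lemma mem_Fopen_of_orbit (π : Fin m ↪ Fin n) {b : Matrix (Fin m) (Fin m) ℂ}
    {c : Matrix (Fin n) (Fin n) ℂ} (hb : b ∈ Bminus m) (hc : c ∈ Bplus n) (s t : Fin m → ℂ)
    (h0 : ∀ i, s i * t i ≠ 0) (hne : ∀ i i' : Fin m, i ≠ i' → s i * t i ≠ s i' * t i') :
    (b * (diagonal s * permMat π) * c⁻¹, c * ((permMat π)ᵀ * diagonal t) * b⁻¹) ∈ Fopen π := by
  have e1 : b * (diagonal s * permMat π) * c⁻¹ * (c * ((permMat π)ᵀ * diagonal t) * b⁻¹)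
      = b * diagonal (fun i => s i * t i) * b⁻¹ := by
    calc _ = b * (diagonal s * (permMat π * (c⁻¹ * c) * (permMat π)ᵀ) * diagonal t) * b⁻¹ := by
          simp only [Matrix.mul_assoc]
      _ = _ := by
        rw [inv_mul_of_isUnit hc.1, Matrix.mul_one, permMat_mul_transpose, Matrix.mul_one,
          diagonal_mul_diagonal]
  have e2 : c * ((permMat π)ᵀ * diagonal t) * b⁻¹ * (b * (diagonal s * permMat π) * c⁻¹)
      = c * diagonal (fun j => ∑ i, if π i = j then s i * t i else 0) * c⁻¹ := by
    calc _ = c * ((permMat π)ᵀ * (diagonal t * (b⁻¹ * b) * diagonal s) * permMat π) * c⁻¹ := by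
          simp only [Matrix.mul_assoc]
      _ = _ := by
        rw [inv_mul_of_isUnit hb.1, Matrix.mul_one, diagonal_mul_diagonal,
          transpose_permMat_mul_diagonal_mul]
        simp only [mul_comm]
  have d1 : ∀ i, (b * diagonal (fun i => s i * t i) * b⁻¹) i i = s i * t i := fun i => by
    rw [LowerTri.conj_apply_self hb (lowerTri_diagonal _), diagonal_apply_eq]
  refine ⟨⟨?_, ?_⟩, fun i => ?_, fun i => ?_, fun i i' hii => ?_⟩
  · rw [e1]
    exact (hb.2.mul (lowerTri_diagonal _)).mul hb.2.inv
  · rw [e2]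
    exact (hc.2.mul (upperTri_diagonal _)).mul hc.2.inv
  · dsimp only
    rw [e1, e2, d1, UpperTri.conj_apply_self hc (upperTri_diagonal _), diagonal_apply_eq]
    simp
  · dsimp only
    rw [e1, d1]
    exact h0 i
  · dsimp only
    rw [e1, d1, d1]
    exact hne i i' hii

lemma Eopen_subset_Fopen (π : Fin m ↪ Fin n) : Eopen π ⊆ Fopen π := by
  rintro ⟨X, Y⟩ ⟨b, hb, c, hc, s, t, h0, hne, hX, hY⟩
  obtain rfl : X = _ := hX
  obtain rfl : Y = _ := hY
  exact mem_Fopen_of_orbit π (Nminus_subset_Bminus hb) (Nplus_subset_Bplus hc) s t h0 hne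

lemma aeval_mul_comm_intertwine (X : Matrix (Fin m) (Fin n) ℂ) (Y : Matrix (Fin n) (Fin m) ℂ)
    (p : Polynomial ℂ) : Polynomial.aeval (Y * X) p * Y = Y * Polynomial.aeval (X * Y) p := by
  induction p using Polynomial.induction_on' with
  | add p q hp hq => rw [map_add, map_add, Matrix.add_mul, Matrix.mul_add, hp, hq]
  | monomial r a =>
    have hpow : ∀ r : ℕ, (Y * X) ^ r * Y = Y * (X * Y) ^ r := fun r => by
      induction r with
      | zero => simp
      | succ r ih =>
        rw [pow_succ, pow_succ, ← Matrix.mul_assoc Y, ← ih]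
        simp only [Matrix.mul_assoc]
    rw [Polynomial.aeval_monomial, Polynomial.aeval_monomial, ← Algebra.smul_def,
      ← Algebra.smul_def, Matrix.smul_mul, Matrix.mul_smul, hpow]

lemma Fopen_subset_Eopen (π : Fin m ↪ Fin n) : Fopen π ⊆ Eopen π := by
  rintro ⟨X, Y⟩ ⟨⟨hL, hU⟩, hπ, h0, hne⟩
  dsimp only at hL hU hπ h0 hne
  set d : Fin m → ℂ := fun i => (X * Y) i i with hd
  set e : Fin n → ℂ := fun j => (Y * X) j j with he
  have hdinj : Function.Injective d := fun i i' h => by_contra fun hii => hne i i' hii h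
  set S : Finset ℂ := Finset.univ.image d with hS
  have hannL : Polynomial.aeval (X * Y) (∏ a ∈ S, (Polynomial.X - Polynomial.C a)) = 0 := by
    rw [hS, Finset.prod_image hdinj.injOn]
    have := charpoly_of_isUpperTriangular _ (lowerTri_iff_transpose.1 hL).isUpperTriangular
    rw [charpoly_transpose] at this
    exact (congrArg (Polynomial.aeval (X * Y)) this).symm.trans (aeval_self_charpoly _)
  have hannU : Polynomial.aeval (Y * X)
      (∏ a ∈ insert 0 S, (Polynomial.X - Polynomial.C a)) = 0 := by
    have h0S : (0 : ℂ) ∉ S := by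
      simpa [hS] using h0
    rw [Finset.prod_insert h0S, Polynomial.C_0, sub_zero, mul_comm, map_mul, Polynomial.aeval_X,
      ← Matrix.mul_assoc, aeval_mul_comm_intertwine, hannL, Matrix.mul_zero, Matrix.zero_mul]
  obtain ⟨b, hb, hbD⟩ := hL.exists_diagonalization S hannL
  obtain ⟨c, hc, hcD⟩ := hU.exists_diagonalization _ hannU
  change X * Y * b = b * diagonal d at hbD
  change Y * X * c = c * diagonal e at hcD
  have hbu := (Nminus_subset_Bminus hb).1
  have hcu := (Nplus_subset_Bplus hc).1
  have heq : ∀ j, e j ≠ 0 → ∃ i, π i = j := by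
    have hsub : Finset.univ.image π ⊆ Finset.univ.filter fun j => e j ≠ 0 := fun j hj => by
      obtain ⟨i, -, rfl⟩ := Finset.mem_image.1 hj
      simpa [he, hπ] using h0 i
    have hcard : (Finset.univ.filter fun j => e j ≠ 0).card ≤ (Finset.univ.image π).card := by
      rw [Finset.card_image_of_injective _ π.injective, Finset.card_univ, Fintype.card_fin,
        ← Fintype.card_subtype, ← rank_diagonal]
      have : diagonal e = c⁻¹ * (Y * (X * c)) := by
        rw [← Matrix.mul_assoc Y, hcD, ← Matrix.mul_assoc, inv_mul_of_isUnit hcu, Matrix.one_mul]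
      rw [this]
      exact (rank_mul_le_right _ _).trans ((rank_mul_le_left _ _).trans Y.rank_le_width)
    intro j hj
    have : j ∈ Finset.univ.image π := by
      rw [Finset.eq_of_subset_of_card_le hsub hcard]
      simpa using hj
    simpa using this
  have hsep : ∀ i j, π i ≠ j → d i ≠ e j := fun i j hij h => by
    obtain ⟨i', rfl⟩ := heq j (h ▸ h0 i)
    have : d i = d i' := h.trans (hπ i')
    exact hij (congrArg π (hdinj this))
  set X₀ := b⁻¹ * X * c with hX₀
  set Y₀ := c⁻¹ * Y * b with hY₀
  have hXX : X = b * X₀ * c⁻¹ := by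
    rw [hX₀, Matrix.mul_assoc, Matrix.mul_assoc, Matrix.mul_assoc, mul_inv_of_isUnit hcu,
      Matrix.mul_one, ← Matrix.mul_assoc, mul_inv_of_isUnit hbu, Matrix.one_mul]
  have hYY : Y = c * Y₀ * b⁻¹ := by
    rw [hY₀, Matrix.mul_assoc, Matrix.mul_assoc, Matrix.mul_assoc, mul_inv_of_isUnit hbu,
      Matrix.mul_one, ← Matrix.mul_assoc, mul_inv_of_isUnit hcu, Matrix.one_mul]
  have hXY₀ : X₀ * Y₀ = diagonal d := by
    calc X₀ * Y₀ = b⁻¹ * X * (c * c⁻¹) * Y * b := by simp only [hX₀, hY₀, Matrix.mul_assoc]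
      _ = b⁻¹ * (X * Y * b) := by
        rw [mul_inv_of_isUnit hcu, Matrix.mul_one]; simp only [Matrix.mul_assoc]
      _ = _ := by rw [hbD, ← Matrix.mul_assoc, inv_mul_of_isUnit hbu, Matrix.one_mul]
  have hYX₀ : Y₀ * X₀ = diagonal e := by
    calc Y₀ * X₀ = c⁻¹ * Y * (b * b⁻¹) * X * c := by simp only [hX₀, hY₀, Matrix.mul_assoc]
      _ = c⁻¹ * (Y * X * c) := by
        rw [mul_inv_of_isUnit hbu, Matrix.mul_one]; simp only [Matrix.mul_assoc]
      _ = _ := by rw [hcD, ← Matrix.mul_assoc, inv_mul_of_isUnit hcu, Matrix.one_mul]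
  have hXzero : ∀ i j, π i ≠ j → X₀ i j = 0 := fun i j hij => by
    have : diagonal d * X₀ = X₀ * diagonal e := by rw [← hXY₀, ← hYX₀, Matrix.mul_assoc]
    have := congrFun (congrFun this i) j
    rw [diagonal_mul, mul_diagonal] at this
    refine (mul_eq_zero.1 ?_).resolve_left (sub_ne_zero.2 (hsep i j hij))
    linear_combination this
  have hYzero : ∀ i j, π i ≠ j → Y₀ j i = 0 := fun i j hij => by
    have : Y₀ * diagonal d = diagonal e * Y₀ := by
      rw [← hXY₀, ← hYX₀, Matrix.mul_assoc Y₀]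
    have := congrFun (congrFun this j) i
    rw [diagonal_mul, mul_diagonal] at this
    refine (mul_eq_zero.1 ?_).resolve_left (sub_ne_zero.2 (hsep i j hij))
    linear_combination this
  let s : Fin m → ℂ := fun i => X₀ i (π i)
  let t : Fin m → ℂ := fun i => Y₀ (π i) i
  have hst : ∀ i, s i * t i = d i := fun i => by
    have := congrFun (congrFun hXY₀ i) i
    rw [diagonal_apply_eq, Matrix.mul_apply] at this
    rw [← this]
    symm
    refine Finset.sum_eq_single (π i) (fun j _ hj => ?_)
      fun h => absurd (Finset.mem_univ _) h
    rw [hXzero i j hj.symm, zero_mul]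
  refine ⟨b, hb, c, hc, s, t, fun i => hst i ▸ h0 i, fun i i' hii => ?_, ?_, ?_⟩
  · rw [hst, hst]
    exact hne i i' hii
  · refine hXX.trans ?_
    congr 2
    ext i j
    rw [diagonal_mul, permMat]
    split_ifs with h
    · simp [s, h]
    · simp [hXzero i j h]
  · refine hYY.trans ?_
    congr 2
    ext j i
    rw [mul_diagonal, transpose_apply, permMat]
    split_ifs with h
    · simp [t, h]
    · simp [hYzero i j h]

lemma Fopen_eq_Eopen (π : Fin m ↪ Fin n) : Fopen π = Eopen π :=
  (Fopen_subset_Eopen π).antisymm (Eopen_subset_Fopen π)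

lemma LUreg_subset_iUnion_Eopen : LUreg m n ⊆ ⋃ ρ : Fin m ↪ Fin n, Eopen ρ := by
  rintro ⟨X, Y⟩ ⟨⟨hL, hU⟩, h0, hne⟩
  dsimp only at hL hU h0 hne
  have hex : ∀ i, ∃ j, (Y * X) j j = (X * Y) i i := fun i => by
    set x := (X * Y) i i with hx
    have h1 : (1 - (x⁻¹ • X) * Y).det = 0 := by
      rw [Matrix.smul_mul, det_of_isLowerTriangular]
      · refine Finset.prod_eq_zero (Finset.mem_univ i) ?_
        rw [Matrix.sub_apply, Matrix.smul_apply, one_apply_eq, ← hx, smul_eq_mul,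
          inv_mul_cancel₀ (h0 i), sub_self]
      · have := lowerTri_one.add (hL.smul (-x⁻¹))
        rw [neg_smul, ← sub_eq_add_neg] at this
        exact this.isLowerTriangular
    rw [det_one_sub_mul_comm, Matrix.mul_smul, det_of_isUpperTriangular] at h1
    · obtain ⟨j, -, hj⟩ := Finset.prod_eq_zero_iff.1 h1
      refine ⟨j, ?_⟩
      rw [Matrix.sub_apply, Matrix.smul_apply, one_apply_eq, smul_eq_mul, sub_eq_zero] at hj
      exact ((inv_mul_eq_one₀ (h0 i)).1 hj.symm).symm
    · have := upperTri_one.add (hU.smul (-x⁻¹))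
      rw [neg_smul, ← sub_eq_add_neg] at this
      exact this.isUpperTriangular
  choose ρ hρ using hex
  have hinj : Function.Injective ρ := fun i i' h => by
    by_contra hii
    exact hne i i' hii (by rw [← hρ, ← hρ, h])
  exact Set.mem_iUnion.2 ⟨⟨ρ, hinj⟩, Fopen_subset_Eopen _ ⟨⟨hL, hU⟩, hρ, h0, hne⟩⟩

lemma LU_eq_iUnion_Ecomp (hmn : m ≤ n) : LU m n = ⋃ ρ : Fin m ↪ Fin n, Ecomp ρ := by
  refine Set.Subset.antisymm (fun p hp => ?_) (Set.iUnion_subset fun ρ => ?_)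
  · refine zclosure_iUnion _ ?_
    exact zclosure_subset_zclosure (LUreg_subset_iUnion_Eopen.trans (subset_zclosure _))
      (LU_subset_zclosure_LUreg hmn hp)
  · have h : Eopen ρ ⊆ LU m n := fun p hp => (Eopen_subset_Fopen ρ hp).1
    exact (zclosure_subset_zclosure (h.trans (subset_zclosure _))).trans zclosure_LU

/-- The saturation of the points `(π, πᵀ s)` under the action of `B_- × B_+`. -/
def Oorbit (π : Fin m ↪ Fin n) : Set (LUSpace m n) :=
  { p | ∃ b ∈ Bminus m, ∃ c ∈ Bplus n, ∃ s : Fin m → ℂ,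
    p.1 = b * permMat π * c⁻¹ ∧ p.2 = c * ((permMat π)ᵀ * diagonal s) * b⁻¹ }

lemma Oorbit_subset_Ecomp (π : Fin m ↪ Fin n) : Oorbit π ⊆ Ecomp π := by
  rintro ⟨X, Y⟩ ⟨b, hb, c, hc, s, hX, hY⟩
  obtain rfl : X = _ := hX
  obtain rfl : Y = _ := hY
  refine mem_zclosure_of_line _
    (0, c * ((permMat π)ᵀ * diagonal fun i : Fin m => (i.val + 1 : ℂ)) * b⁻¹) ?_
  filter_upwards [eventually_distinct_nonzero s] with ε hε
  refine subset_zclosure _ (Fopen_subset_Eopen π ?_)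
  have := mem_Fopen_of_orbit π hb hc (fun _ => 1) (fun i => s i + ε * (i.val + 1 : ℂ))
    (by simpa using hε.1) (by simpa using hε.2)
  convert this using 1
  have hdiag : (diagonal fun i => s i + ε * (i.val + 1 : ℂ))
      = diagonal s + ε • diagonal fun i : Fin m => (i.val + 1 : ℂ) := by
    rw [← diagonal_smul, diagonal_add]
    rfl
  rw [hdiag, diagonal_one]
  ext1
  · simp
  · simp [Matrix.mul_add, Matrix.add_mul]

lemma Eopen_subset_Oorbit (π : Fin m ↪ Fin n) : Eopen π ⊆ Oorbit π := by
  rintro ⟨X, Y⟩ ⟨b, hb, c, hc, s, t, h0, -, hX, hY⟩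
  have hs : ∀ i, s i ≠ 0 := fun i h => h0 i (by rw [h, zero_mul])
  have hdiag : diagonal s ∈ Bminus m :=
    ⟨(lowerTri_diagonal s).isUnit_of_diag_ne_zero (by simpa using hs), lowerTri_diagonal s⟩
  refine ⟨b * diagonal s, mul_mem_Bminus (Nminus_subset_Bminus hb) hdiag, c,
    Nplus_subset_Bplus hc, fun i => t i * s i, ?_, ?_⟩
  · rw [hX]
    simp only [Matrix.mul_assoc]
  · rw [hY, Matrix.mul_inv_rev, ← diagonal_mul_diagonal]
    calc _ = c * ((permMat π)ᵀ * (diagonal t * 1)) * b⁻¹ := by rw [Matrix.mul_one]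
      _ = _ := by
        rw [← mul_inv_of_isUnit hdiag.1]
        simp only [Matrix.mul_assoc]

lemma fst_image_Ecomp (π : Fin m ↪ Fin n) :
    Prod.fst '' Ecomp π =
      mzclosure { X | ∃ b ∈ Bminus m, ∃ c ∈ Bplus n, X = b * permMat π * c } := by
  refine Set.Subset.antisymm ?_ fun X hX => ⟨(X, 0), fun f hf => ?_, rfl⟩
  · rintro _ ⟨p, hp, rfl⟩ f hf
    have := hp (MvPolynomial.rename Sum.inl f) fun q hq => by
      obtain ⟨b, hb, c, hc, s, h1, -⟩ := Eopen_subset_Oorbit π hq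
      rw [MvPolynomial.eval_rename]
      exact hf q.1 ⟨b, hb, c⁻¹, inv_mem_Bplus hc, h1⟩
    rwa [MvPolynomial.eval_rename] at this
  · let g : MvPolynomial (Fin m × Fin n) ℂ :=
      MvPolynomial.aeval (Sum.elim MvPolynomial.X fun _ => 0) f
    have hg : ∀ X' : Matrix (Fin m) (Fin n) ℂ,
        MvPolynomial.eval (fun ij => X' ij.1 ij.2) g
          = MvPolynomial.eval (coordsOf ((X', 0) : LUSpace m n)) f := fun X' => by
      simp only [g, MvPolynomial.aeval_def, MvPolynomial.hom_eval₂, MvPolynomial.eval,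
        MvPolynomial.coe_eval₂Hom]
      congr 1
      · ext x
        simp
      · ext i
        rcases i with i | i <;> simp [coordsOf]
    rw [← hg]
    refine hX g ?_
    rintro _ ⟨b, hb, c, hc, rfl⟩
    rw [hg]
    refine Oorbit_subset_Ecomp π ⟨b, hb, c⁻¹, inv_mem_Bplus hc, 0, ?_, ?_⟩ f hf
    · rw [nonsing_inv_nonsing_inv _ ((isUnit_iff_isUnit_det _).1 hc.1)]
    · simp

end Components

/-- Proposition (components of the lower-upper scheme): the closures of `E°_π`, `F_π`, `O_π`
coincide; `E` is the union of the `E_π`; and the first projection of `E_π` is the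
matrix Schubert variety (closure of `B_- π B_+`). -/
theorem closure_descriptions_and_components (m n : ℕ) (hm : 1 ≤ m) (hmn : m ≤ n)
    (π : Fin m ↪ Fin n) :
    (zclosure { p | p ∈ LU m n ∧ (∀ i : Fin m, (p.2 * p.1) (π i) (π i) = (p.1 * p.2) i i) ∧
        (∀ i : Fin m, (p.1 * p.2) i i ≠ 0) ∧
        (∀ i i' : Fin m, i ≠ i' → (p.1 * p.2) i i ≠ (p.1 * p.2) i' i') } = Ecomp π) ∧
    (zclosure { p | ∃ b ∈ Bminus m, ∃ c ∈ Bplus n, ∃ s : Fin m → ℂ,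
        p.1 = b * permMat π * c⁻¹ ∧
        p.2 = c * ((permMat π)ᵀ * Matrix.diagonal s) * b⁻¹ } = Ecomp π) ∧
    (LU m n = ⋃ ρ : Fin m ↪ Fin n, Ecomp ρ) ∧
    (Prod.fst '' Ecomp π =
      mzclosure { X | ∃ b ∈ Bminus m, ∃ c ∈ Bplus n, X = b * permMat π * c }) := by
  refine ⟨congrArg zclosure (Fopen_eq_Eopen π), ?_, LU_eq_iUnion_Ecomp hmn, fst_image_Ecomp π⟩
  exact (zclosure_subset_zclosure (Oorbit_subset_Ecomp π)).antisymm
    (zclosure_subset_zclosure ((Eopen_subset_Oorbit π).trans (subset_zclosure _)))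
end

section
/- The lower-upper scheme E is generically reduced: for every minimal prime P of R lying over the ideal I_E, the localization of R/I_E at (the image of) P is a reduced ring. -/
/-- The polynomial ring `R = ℂ[X_{ij}, Y_{ji}]`. -/
abbrev LUPolyRing (m n : ℕ) := MvPolynomial ((Fin m × Fin n) ⊕ (Fin n × Fin m)) ℂ

/-- The generic `m×n` matrix `X`. -/
noncomputable def genX (m n : ℕ) : Matrix (Fin m) (Fin n) (LUPolyRing m n) :=
  fun i j => MvPolynomial.X (Sum.inl (i, j))

/-- The generic `n×m` matrix `Y`. -/
noncomputable def genY (m n : ℕ) : Matrix (Fin n) (Fin m) (LUPolyRing m n) :=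
  fun j i => MvPolynomial.X (Sum.inr (j, i))

/-- The ideal `I_E` generated by the strictly-upper entries of `XY` and strictly-lower
entries of `YX`. -/
noncomputable def idealE (m n : ℕ) : Ideal (LUPolyRing m n) :=
  Ideal.span ({ q | ∃ i i' : Fin m, i < i' ∧ q = (genX m n * genY m n) i i' } ∪
    { q | ∃ j j' : Fin n, j' < j ∧ q = (genY m n * genX m n) j j' })

namespace LowerUpper

open Matrix

set_option linter.unusedSectionVars false

variable {ι κ : Type*} [Fintype ι] [Fintype κ] [DecidableEq ι] [DecidableEq κ]

/-- The partial monomial matrix with entry `d i` at position `(i, σ i)`. -/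
def monomialMatrix {A : Type*} [Zero A] (σ : ι → κ) (d : ι → A) : Matrix ι κ A :=
  fun i j => if j = σ i then d i else 0

theorem one_sub_mul_one_add_of_sq_eq_zero {A : Type*} [Ring A] {e : A} (he : e * e = 0) :
    (1 - e) * (1 + e) = 1 := by
  rw [sub_mul, mul_add, mul_add, he]; simp

/-- Every matrix over a field can be brought to a partial monomial form, in the rows of an upper
closed set `s`, by triangular row and column operations. -/
theorem exists_triangular_reduction {K : Type*} [Field K] (β : ι → ℤ) (γ : κ → ℤ)
    (M : Matrix ι κ K) (s : Finset ι) (hs : ∀ i ∈ s, ∀ i', β i < β i' → i' ∈ s) :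
    ∃ (L L' : Matrix ι ι K) (U U' : Matrix κ κ K),
      L.BlockTriangular β ∧ L'.BlockTriangular β ∧ U.BlockTriangular γ ∧ U'.BlockTriangular γ ∧
      L * L' = 1 ∧ U * U' = 1 ∧
      ∀ i ∈ s, ∀ j, (L * M * U) i j ≠ 0 →
        (∀ j', j' ≠ j → (L * M * U) i j' = 0) ∧ (∀ i', i' ≠ i → (L * M * U) i' j = 0) := by
  classical
  induction s using Finset.induction_on_min_value β with
  | empty =>
    exact ⟨1, 1, 1, 1, blockTriangular_one, blockTriangular_one, blockTriangular_one,
      blockTriangular_one, by simp, by simp, by simp⟩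
  | insert a s ha hmin ih =>
    have hs' : ∀ i ∈ s, ∀ i', β i < β i' → i' ∈ s := by
      intro i hi i' hlt
      have h1 := hs i (Finset.mem_insert_of_mem hi) i' hlt
      rcases Finset.mem_insert.1 h1 with rfl | h
      · exact absurd (hmin i hi) (by omega)
      · exact h
    obtain ⟨L, L', U, U', hL, hL', hU, hU', hLL, hUU, hN⟩ := ih hs'
    set N := L * M * U with hNdef
    by_cases hrow : ∀ j, N a j = 0
    · refine ⟨L, L', U, U', hL, hL', hU, hU', hLL, hUU, ?_⟩
      intro i hi j hij
      rcases Finset.mem_insert.1 hi with rfl | h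
      · exact absurd (hrow j) hij
      · exact hN i h j hij
    push Not at hrow
    obtain ⟨j₀, hj₀, hj₀min⟩ := Finset.exists_min_image (Finset.univ.filter fun j => N a j ≠ 0) γ
      (by obtain ⟨j, hj⟩ := hrow; exact ⟨j, by simpa using hj⟩)
    have hp : N a j₀ ≠ 0 := by simpa using hj₀
    have hj₀min' : ∀ j, N a j ≠ 0 → γ j₀ ≤ γ j := fun j hj => hj₀min j (by simpa using hj)
    have hcol : ∀ i ∈ s, N i j₀ = 0 := by
      intro i hi
      by_contra h
      exact hp ((hN i hi j₀ h).2 a (by rintro rfl; exact ha hi))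
    let c : ι → K := fun i => if i = a then 0 else N i j₀ / N a j₀
    let r : κ → K := fun j => if j = j₀ then 0 else N a j / N a j₀
    have hEE : vecMulVec c (Pi.single a 1) * vecMulVec c (Pi.single a 1) = 0 := by
      rw [vecMulVec_mul_vecMulVec]; simp [c]
    have hFF : vecMulVec (Pi.single j₀ 1) r * vecMulVec (Pi.single j₀ 1) r = 0 := by
      rw [vecMulVec_mul_vecMulVec]; simp [r]
    have hEtri : (vecMulVec c (Pi.single a 1)).BlockTriangular β := by
      intro i i' hlt
      simp only [vecMulVec_apply, Pi.single_apply]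
      split_ifs with h
      · subst h
        have : c i = 0 := by
          by_cases hi : i = i'
          · simp [c, hi]
          · have h1 := hs i' (Finset.mem_insert_self _ _) i hlt
            simp [c, hcol i ((Finset.mem_insert.1 h1).resolve_left hi)]
        simp [this]
      · simp
    have hFtri : (vecMulVec (Pi.single j₀ 1) r).BlockTriangular γ := by
      intro j j' hlt
      simp only [vecMulVec_apply, Pi.single_apply]
      split_ifs with h
      · subst h
        have : r j' = 0 := by
          by_contra h0
          have : N a j' ≠ 0 := by
            intro h1
            exact h0 (by simp [r, h1])
          exact absurd (hj₀min' j' this) (by omega)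
        simp [this]
      · simp
    obtain ⟨N', hN'def⟩ : ∃ N' : Matrix ι κ K, N' = (1 - vecMulVec c (Pi.single a 1)) * L * M *
      (U * (1 - vecMulVec (Pi.single j₀ 1) r)) := ⟨_, rfl⟩
    have hentry : ∀ i j, N' i j =
        (N i j - c i * N a j) - (N i j₀ - c i * N a j₀) * r j := by
      intro i j
      have h1 : (1 - vecMulVec c (Pi.single a 1)) * N = N - vecMulVec c (N.row a) := by
        rw [Matrix.sub_mul, Matrix.one_mul, vecMulVec_mul, single_one_vecMul]
      have h2 : N' = (N - vecMulVec c (N.row a)) -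
          vecMulVec ((N - vecMulVec c (N.row a)) *ᵥ Pi.single j₀ 1) r := by
        rw [← mul_vecMulVec, ← h1, hN'def, hNdef]
        simp only [Matrix.mul_assoc, Matrix.mul_sub, Matrix.mul_one]
      rw [h2]
      simp [vecMulVec_apply, Matrix.sub_apply]
    refine ⟨(1 - vecMulVec c (Pi.single a 1)) * L, L' * (1 + vecMulVec c (Pi.single a 1)),
      U * (1 - vecMulVec (Pi.single j₀ 1) r), (1 + vecMulVec (Pi.single j₀ 1) r) * U',
      (blockTriangular_one.sub hEtri).mul hL, hL'.mul (blockTriangular_one.add hEtri),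
      hU.mul (blockTriangular_one.sub hFtri), (blockTriangular_one.add hFtri).mul hU', ?_, ?_, ?_⟩
    · rw [Matrix.mul_assoc, ← Matrix.mul_assoc L, hLL, Matrix.one_mul,
        one_sub_mul_one_add_of_sq_eq_zero hEE]
    · rw [Matrix.mul_assoc, ← Matrix.mul_assoc (1 - _), one_sub_mul_one_add_of_sq_eq_zero hFF,
        Matrix.one_mul, hUU]
    · rw [← hN'def]
      have hother : ∀ i, i ≠ a → ∀ j, N' i j = N i j - c i * N a j := by
        intro i hi j
        rw [hentry]
        have : N i j₀ - c i * N a j₀ = 0 := by simp [c, hi, hp]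
        rw [this]; ring
      have hpiv : ∀ j, N' a j = if j = j₀ then N a j₀ else 0 := by
        intro j
        rw [hentry]
        by_cases hj : j = j₀
        · simp [c, r, hj]
        · simp [c, r, hj]; field_simp; simp
      intro i hi j hij
      rcases Finset.mem_insert.1 hi with rfl | h
      · have hj : j = j₀ := by
          by_contra h; exact hij (by rw [hpiv, if_neg h])
        subst hj
        refine ⟨fun j' hj' => by rw [hpiv, if_neg hj'], fun i' hi' => ?_⟩
        rw [hother i' hi']; simp [c, hi', hp]
      · have hia : i ≠ a := by rintro rfl; exact ha h
        have hci : c i = 0 := by simp [c, hcol i h]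
        rw [hother i hia, hci, zero_mul, sub_zero] at hij
        obtain ⟨h1, h2⟩ := hN i h j hij
        refine ⟨fun j' hj' => by rw [hother i hia, hci, h1 j' hj']; ring, fun i' hi' => ?_⟩
        have haj : N a j = 0 := h2 a hia.symm
        by_cases hi'a : i' = a
        · subst hi'a
          rw [hpiv, if_neg]
          rintro rfl; exact hp haj
        · rw [hother i' hi'a, h2 i' hi', haj]; ring

/-- Bruhat-type decomposition of a matrix with at least as many columns as rows. -/
theorem exists_bruhat {K : Type*} [Field K] (hc : Fintype.card ι ≤ Fintype.card κ)
    (β : ι → ℤ) (γ : κ → ℤ) (M : Matrix ι κ K) :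
    ∃ (L L' : Matrix ι ι K) (U U' : Matrix κ κ K) (σ : ι → κ) (d : ι → K),
      L.BlockTriangular β ∧ L'.BlockTriangular β ∧ U.BlockTriangular γ ∧ U'.BlockTriangular γ ∧
      L * L' = 1 ∧ U * U' = 1 ∧ Function.Injective σ ∧ M = L * monomialMatrix σ d * U := by
  classical
  obtain ⟨L, L', U, U', hL, hL', hU, hU', hLL, hUU, hN⟩ :=
    exists_triangular_reduction β γ M Finset.univ (by simp)
  have hLL' := mul_eq_one_comm.1 hLL
  have hUU' := mul_eq_one_comm.1 hUU
  set N := L * M * U with hNdef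
  have hex : ∀ i, ∃ j, i ∈ Finset.univ.filter (fun i => ∃ j, N i j ≠ 0) → N i j ≠ 0 := by
    intro i
    by_cases h : ∃ j, N i j ≠ 0
    · exact ⟨h.choose, fun _ => h.choose_spec⟩
    · have : Nonempty κ := Fintype.card_pos_iff.1
        (lt_of_lt_of_le (Fintype.card_pos_iff.2 ⟨i⟩) hc)
      exact ⟨Classical.arbitrary κ, fun h' => absurd (by simpa using h') h⟩
  choose f hf using hex
  obtain ⟨t, ht, -, htc⟩ := Finset.exists_subsuperset_card_eq
    (Finset.subset_univ ((Finset.univ.filter (fun i => ∃ j, N i j ≠ 0)).image f))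
    (n := Fintype.card ι) (Finset.card_image_le.trans (Finset.card_le_univ _)) (by simpa using hc)
  obtain ⟨g, hg⟩ := Finset.exists_equiv_extend_of_card_eq htc.symm ht (by
    intro i hi i' hi' h
    by_contra hne
    have h1 := (hN i (Finset.mem_univ _) (f i) (hf i hi)).2 i' (Ne.symm hne)
    rw [h] at h1
    exact hf i' hi' h1)
  refine ⟨L', L, U', U, fun i => g i, fun i => N i (g i), hL', hL, hU', hU, hLL', hUU',
    Subtype.val_injective.comp g.injective, ?_⟩
  have : monomialMatrix (fun i => (g i : κ)) (fun i => N i (g i)) = N := by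
    ext i j
    simp only [monomialMatrix]
    split_ifs with h
    · rw [h]
    · by_contra h0
      have hi : i ∈ Finset.univ.filter (fun i => ∃ j, N i j ≠ 0) := by
        simp only [Finset.mem_filter, Finset.mem_univ, true_and]
        exact ⟨j, Ne.symm h0⟩
      rw [hg i hi] at h
      exact h0 ((hN i (Finset.mem_univ _) (f i) (hf i hi)).1 j h).symm
  rw [this, hNdef, Matrix.mul_assoc, Matrix.mul_assoc, hUU, Matrix.mul_one, ← Matrix.mul_assoc,
    hLL', Matrix.one_mul]

theorem monomialMatrix_mul_transpose {A : Type*} [CommRing A] {σ : ι → κ}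
    (hσ : Function.Injective σ) (d w : ι → A) :
    monomialMatrix σ d * (monomialMatrix σ w)ᵀ = diagonal fun i => d i * w i := by
  ext i i'
  rw [mul_apply, Finset.sum_eq_single (σ i) (fun j _ hj => by simp [monomialMatrix, hj]) (by simp)]
  by_cases h : i = i'
  · simp [monomialMatrix, h]
  · simp [monomialMatrix, hσ.eq_iff, h]

theorem transpose_mul_monomialMatrix {A : Type*} [CommRing A] (σ : ι → κ) (d w : ι → A) :
    ∃ e : κ → A, (monomialMatrix σ w)ᵀ * monomialMatrix σ d = diagonal e := by
  refine ⟨fun j => ((monomialMatrix σ w)ᵀ * monomialMatrix σ d) j j, ?_⟩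
  ext j j'
  by_cases h : j = j'
  · simp [h]
  · rw [diagonal_apply_ne _ h, mul_apply]
    refine Finset.sum_eq_zero fun i _ => ?_
    simp only [monomialMatrix, transpose_apply]
    split_ifs with h1 h2
    · exact absurd (h1.trans h2.symm) h
    all_goals simp

theorem mul_conj_mul {A : Type*} [CommRing A] {U U' : Matrix κ κ A} (hU : U * U' = 1)
    (L L' : Matrix ι ι A) (D : Matrix ι κ A) (W : Matrix κ ι A) :
    L * D * U * (U' * W * L') = L * (D * W) * L' := by
  have : L * D * U * (U' * W * L') = L * (D * (U * U') * W) * L' := by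
    simp only [Matrix.mul_assoc]
  rw [this, hU, Matrix.mul_one]

theorem blockTriangular_mul_diag {A : Type*} [CommRing A] {β : ι → ℤ}
    (hβ : Function.Injective β) {M N : Matrix ι ι A} (hM : M.BlockTriangular β)
    (hN : N.BlockTriangular β) (i : ι) : (M * N) i i = M i i * N i i := by
  rw [mul_apply]
  refine Finset.sum_eq_single i (fun k _ hk => ?_) (by simp)
  rcases lt_trichotomy (β k) (β i) with h | h | h
  · rw [hM h, zero_mul]
  · exact absurd (hβ h) hk
  · rw [hN h, mul_zero]

/-- For every matrix `X` there is a full rank `Y` with `XY` and `YX` triangular. -/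
theorem exists_full_rank_partner {K : Type*} [Field K] (hc : Fintype.card ι ≤ Fintype.card κ)
    (β : ι → ℤ) (γ : κ → ℤ) (X : Matrix ι κ K) :
    ∃ (Y : Matrix κ ι K) (G : Matrix ι κ K), (X * Y).BlockTriangular β ∧
      (Y * X).BlockTriangular γ ∧ G * Y = 1 := by
  obtain ⟨L, L', U, U', σ, d, hL, hL', hU, hU', hLL, hUU, hσ, rfl⟩ := exists_bruhat hc β γ X
  have hLL' := mul_eq_one_comm.1 hLL
  obtain ⟨e, he⟩ := transpose_mul_monomialMatrix σ d (1 : ι → K)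
  have hdiag := fun d : ι → K => monomialMatrix_mul_transpose hσ d 1
  generalize (monomialMatrix σ (1 : ι → K))ᵀ = W at he hdiag
  refine ⟨U' * W * L', L * monomialMatrix σ (1 : ι → K) * U, ?_, ?_, ?_⟩
  · rw [mul_conj_mul hUU, hdiag]
    exact (hL.mul (blockTriangular_diagonal _)).mul hL'
  · rw [mul_conj_mul hLL', he]
    exact (hU'.mul (blockTriangular_diagonal _)).mul hU
  · rw [mul_conj_mul hUU, hdiag]
    simp [hLL]

/-- If the rows of `X` are independent, there is `Y` with `XY` and `YX` triangular and with
prescribed diagonal of `XY`. -/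
theorem exists_partner_diag {K : Type*} [Field K] (hc : Fintype.card ι ≤ Fintype.card κ)
    {β : ι → ℤ} (hβ : Function.Injective β) (γ : κ → ℤ) (X : Matrix ι κ K)
    (hX : ∀ v : ι → K, v ᵥ* X = 0 → v = 0) (w : ι → K) :
    ∃ Y : Matrix κ ι K, (X * Y).BlockTriangular β ∧ (Y * X).BlockTriangular γ ∧
      ∀ i, (X * Y) i i = w i := by
  obtain ⟨L, L', U, U', σ, d, hL, hL', hU, hU', hLL, hUU, hσ, rfl⟩ := exists_bruhat hc β γ X
  have hLL' := mul_eq_one_comm.1 hLL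
  have hd : ∀ i, d i ≠ 0 := by
    intro i hi
    have h1 : (Pi.single i 1 : ι → K) ᵥ* monomialMatrix σ d = 0 := by
      ext j
      simp [monomialMatrix, hi]
    have h2 := hX (Pi.single i 1 ᵥ* L') (by
      rw [vecMul_vecMul, ← Matrix.mul_assoc, ← Matrix.mul_assoc, hLL', Matrix.one_mul,
        ← vecMul_vecMul, h1, zero_vecMul])
    have h3 : (Pi.single i 1 : ι → K) = 0 := by
      have := congrArg (· ᵥ* L) h2
      simpa only [vecMul_vecMul, hLL', vecMul_one, zero_vecMul] using this
    simpa using congrFun h3 i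
  obtain ⟨e, he⟩ := transpose_mul_monomialMatrix σ d (fun i => w i / d i)
  have hdiag := monomialMatrix_mul_transpose hσ d (fun i => w i / d i)
  generalize (monomialMatrix σ fun i => w i / d i)ᵀ = W at he hdiag
  simp only [mul_div_cancel₀ _ (hd _)] at hdiag
  refine ⟨U' * W * L', ?_, ?_, fun i => ?_⟩
  · rw [mul_conj_mul hUU, hdiag]
    exact (hL.mul (blockTriangular_diagonal _)).mul hL'
  · rw [mul_conj_mul hLL', he]
    exact (hU'.mul (blockTriangular_diagonal _)).mul hU
  · rw [mul_conj_mul hUU, hdiag, blockTriangular_mul_diag hβ (hL.mul (blockTriangular_diagonal _)) hL',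
      blockTriangular_mul_diag hβ hL (blockTriangular_diagonal _), diagonal_apply_eq,
      mul_right_comm, ← blockTriangular_mul_diag hβ hL hL', hLL, one_apply_eq, one_mul]

/-- A matrix with a left inverse has a nonzero maximal minor. -/
theorem exists_det_submatrix_ne_zero {K : Type*} [Field K] (G : Matrix ι κ K) (Y : Matrix κ ι K)
    (h : G * Y = 1) : ∃ s : ι → κ, (Y.submatrix s id).det ≠ 0 := by
  by_contra hcon
  push Not at hcon
  have h1 : (G * Y).det = 0 := by
    have hrow : G * Y = fun i => ∑ j, G i j • Y j := by
      ext i k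
      simp [mul_apply, Finset.sum_apply]
    rw [hrow]
    change detRowAlternating.toMultilinearMap (fun i => ∑ j, G i j • Y j) = 0
    rw [MultilinearMap.map_sum]
    refine Finset.sum_eq_zero fun s _ => ?_
    rw [MultilinearMap.map_smul_univ]
    have : detRowAlternating.toMultilinearMap (fun i => Y (s i)) = 0 := hcon s
    rw [this, smul_zero]
  rw [h, det_one] at h1
  exact one_ne_zero h1

section Triangular

variable {A : Type*} [CommRing A] {β : ι → ℤ}

theorem det_eq_prod_diag (hβ : Function.Injective β) {M : Matrix ι ι A}
    (hM : M.BlockTriangular β) : M.det = ∏ i, M i i := by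
  let _ : LinearOrder ι := LinearOrder.lift' β hβ
  have hM' : M.BlockTriangular id := fun i j hij => hM hij
  convert det_of_isUpperTriangular hM'

theorem charpoly_eq_prod_diag (hβ : Function.Injective β) {M : Matrix ι ι A}
    (hM : M.BlockTriangular β) :
    M.charpoly = ∏ i, (Polynomial.X - Polynomial.C (M i i)) := by
  let _ : LinearOrder ι := LinearOrder.lift' β hβ
  have hM' : M.BlockTriangular id := fun i j hij => hM hij
  convert charpoly_of_isUpperTriangular M hM'

theorem blockTriangular_aeval {M : Matrix ι ι A} (hM : M.BlockTriangular β)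
    (q : Polynomial A) : (Polynomial.aeval M q).BlockTriangular β := by
  induction q using Polynomial.induction_on' with
  | add p q hp hq => rw [map_add]; exact hp.add hq
  | monomial k a =>
    have hpow : (M ^ k).BlockTriangular β := by
      induction k with
      | zero => rw [pow_zero]; exact blockTriangular_one
      | succ k ih => rw [pow_succ]; exact ih.mul hM
    intro i j hij
    rw [Polynomial.aeval_monomial, ← Algebra.smul_def, Matrix.smul_apply, hpow hij, smul_zero]

theorem aeval_diag (hβ : Function.Injective β) {M : Matrix ι ι A} (hM : M.BlockTriangular β)
    (q : Polynomial A) (i : ι) : Polynomial.aeval M q i i = q.eval (M i i) := by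
  have hpow : ∀ k : ℕ, (M ^ k).BlockTriangular β ∧ (M ^ k) i i = M i i ^ k := by
    intro k
    induction k with
    | zero => rw [pow_zero]; exact ⟨blockTriangular_one, by simp⟩
    | succ k ih =>
      rw [pow_succ, pow_succ, blockTriangular_mul_diag hβ ih.1 hM, ih.2]
      exact ⟨ih.1.mul hM, rfl⟩
  induction q using Polynomial.induction_on' with
  | add p q hp hq => rw [map_add, Polynomial.eval_add, ← hp, ← hq, Matrix.add_apply]
  | monomial k a =>
    rw [Polynomial.aeval_monomial, ← Algebra.smul_def, Matrix.smul_apply, (hpow k).2,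
      Polynomial.eval_monomial, smul_eq_mul]

theorem exists_triangular_inverse (hβ : Function.Injective β) {M : Matrix ι ι A}
    (hM : M.BlockTriangular β) (h : ∀ i, M i i = 1) :
    ∃ M' : Matrix ι ι A, M'.BlockTriangular β ∧ M * M' = 1 := by
  have hdet : IsUnit M.det := by rw [det_eq_prod_diag hβ hM]; simp [h]
  let _ := M.invertibleOfIsUnitDet hdet
  exact ⟨M⁻¹, blockTriangular_inv_of_blockTriangular hM, M.mul_nonsing_inv hdet⟩

/-- A triangular matrix annihilated by a separated split polynomial is diagonalized by a
unipotent triangular matrix. -/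
theorem exists_triangular_eigenbasis {τ : Type*} [Fintype τ] [DecidableEq τ]
    (hβ : Function.Injective β) {T : Matrix ι ι A} (hT : T.BlockTriangular β) (r : τ → A)
    (hr : ∀ k l, k ≠ l → IsUnit (r k - r l))
    (hann : Polynomial.aeval T (∏ k, (Polynomial.X - Polynomial.C (r k))) = 0) (f : ι → τ)
    (hf : ∀ i, T i i = r (f i)) :
    ∃ U : Matrix ι ι A, U.BlockTriangular β ∧ (∀ i, U i i = 1) ∧
      T * U = U * diagonal fun i => r (f i) := by
  let q : τ → Polynomial A := fun k =>
    ∏ l ∈ Finset.univ.erase k, (Polynomial.X - Polynomial.C (r l))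
  have hq : ∀ k, T * Polynomial.aeval T (q k) = r k • Polynomial.aeval T (q k) := by
    intro k
    have h : (∏ l, (Polynomial.X - Polynomial.C (r l))) =
        (Polynomial.X - Polynomial.C (r k)) * q k :=
      (Finset.mul_prod_erase _ _ (Finset.mem_univ k)).symm
    rw [h, map_mul, map_sub, Polynomial.aeval_X, Polynomial.aeval_C, sub_mul, sub_eq_zero,
      ← Algebra.smul_def] at hann
    exact hann
  have hu : ∀ k, IsUnit ((q k).eval (r k)) := by
    intro k
    rw [Polynomial.eval_prod]
    refine (Finset.prod_induction _ IsUnit (fun _ _ => IsUnit.mul) isUnit_one fun l hl => ?_)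
    simpa using hr k l (Finset.ne_of_mem_erase hl).symm
  choose u hu' using fun k => (hu k).exists_right_inv
  refine ⟨of fun i j => Polynomial.aeval T (q (f j)) i j * u (f j), ?_, ?_, ?_⟩
  · intro i j hij
    rw [of_apply, blockTriangular_aeval hT _ hij, zero_mul]
  · intro i
    rw [of_apply, aeval_diag hβ hT, hf, hu']
  · ext i j
    have h := congrFun (congrFun (hq (f j)) i) j
    rw [mul_apply, Matrix.smul_apply, smul_eq_mul] at h
    rw [mul_diagonal, mul_apply]
    simp only [of_apply, ← mul_assoc]
    rw [← Finset.sum_mul, h]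
    ring

end Triangular

section Generic

open MvPolynomial

variable {m n : ℕ}

/-- The block function for which block triangular means lower triangular. -/
def lowerIndex (m : ℕ) (i : Fin m) : ℤ := -(i : ℤ)

/-- The block function for which block triangular means upper triangular. -/
def upperIndex (n : ℕ) (j : Fin n) : ℤ := (j : ℤ)

theorem lowerIndex_injective (m : ℕ) : Function.Injective (lowerIndex m) := by
  intro i i' h
  simp only [lowerIndex] at h
  omega

theorem upperIndex_injective (n : ℕ) : Function.Injective (upperIndex n) := by
  intro i i' h
  simp only [upperIndex] at h
  omega

/-- `XY` is lower triangular and `YX` is upper triangular. -/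
def OnE {A : Type*} [CommRing A] (X : Matrix (Fin m) (Fin n) A) (Y : Matrix (Fin n) (Fin m) A) :
    Prop :=
  (X * Y).BlockTriangular (lowerIndex m) ∧ (Y * X).BlockTriangular (upperIndex n)

theorem idealE_le_ker_iff {A : Type*} [CommRing A] (f : LUPolyRing m n →+* A) :
    idealE m n ≤ RingHom.ker f ↔ OnE ((genX m n).map f) ((genY m n).map f) := by
  rw [idealE, Ideal.span_le, OnE, ← Matrix.map_mul, ← Matrix.map_mul]
  constructor
  · intro h
    refine ⟨fun i i' hlt => h (Or.inl ⟨i, i', ?_, rfl⟩), fun j j' hlt => h (Or.inr ⟨j, j', ?_, rfl⟩)⟩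
    · simp only [lowerIndex] at hlt
      omega
    · simp only [upperIndex] at hlt
      omega
  · rintro ⟨h1, h2⟩ q (⟨i, i', hlt, rfl⟩ | ⟨j, j', hlt, rfl⟩)
    · exact h1 (show lowerIndex m i' < lowerIndex m i by simp only [lowerIndex]; omega)
    · exact h2 (show upperIndex n j' < upperIndex n j by simp only [upperIndex]; omega)

/-- The evaluation homomorphism at a pair of matrices. -/
noncomputable def point {A : Type*} [CommRing A] [Algebra ℂ A] (X : Matrix (Fin m) (Fin n) A)
    (Y : Matrix (Fin n) (Fin m) A) : LUPolyRing m n →ₐ[ℂ] A :=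
  aeval (Sum.elim (fun p => X p.1 p.2) (fun p => Y p.1 p.2))

theorem genX_map_point {A : Type*} [CommRing A] [Algebra ℂ A] (X : Matrix (Fin m) (Fin n) A)
    (Y : Matrix (Fin n) (Fin m) A) : (genX m n).map (point X Y) = X := by
  ext i j
  simp [genX, point]

theorem genY_map_point {A : Type*} [CommRing A] [Algebra ℂ A] (X : Matrix (Fin m) (Fin n) A)
    (Y : Matrix (Fin n) (Fin m) A) : (genY m n).map (point X Y) = Y := by
  ext i j
  simp [genY, point]

theorem comp_point {A B : Type*} [CommRing A] [Algebra ℂ A] [CommRing B] [Algebra ℂ B]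
    (f : A →ₐ[ℂ] B) (X : Matrix (Fin m) (Fin n) A) (Y : Matrix (Fin n) (Fin m) A)
    (r : LUPolyRing m n) : f (point X Y r) = point (X.map f) (Y.map f) r := by
  have : f.comp (point X Y) = point (X.map f) (Y.map f) := by
    ext p
    rcases p with p | p <;> simp [point]
  exact DFunLike.congr_fun this r

theorem point_gen {A : Type*} [CommRing A] [Algebra ℂ A] (g : LUPolyRing m n →ₐ[ℂ] A)
    (r : LUPolyRing m n) : point ((genX m n).map g) ((genY m n).map g) r = g r := by
  have : point ((genX m n).map g) ((genY m n).map g) = g := by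
    ext p
    rcases p with p | p <;> simp [point, genX, genY]
  exact DFunLike.congr_fun this r

/-- A family over a domain which specializes to a point of a component `P` lies over `P`. -/
theorem point_eq_zero_of_mem {P : Ideal (LUPolyRing m n)} (hP : P ∈ (idealE m n).minimalPrimes)
    {S : Type*} [CommRing S] [IsDomain S] [Algebra ℂ S] {X : Matrix (Fin m) (Fin n) S}
    {Y : Matrix (Fin n) (Fin m) S} (hXY : OnE X Y) (h : ∀ r, point X Y r = 0 → r ∈ P)
    {r : LUPolyRing m n} (hr : r ∈ P) : point X Y r = 0 := by
  have hE : idealE m n ≤ RingHom.ker (point X Y : LUPolyRing m n →+* S) := by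
    rw [idealE_le_ker_iff]
    change OnE ((genX m n).map (point X Y)) ((genY m n).map (point X Y))
    rwa [genX_map_point, genY_map_point]
  exact hP.2 ⟨RingHom.ker_isPrime _, hE⟩ (fun r hr => h r hr) hr

theorem blockTriangular_combination {ι κ α A : Type*} [Fintype κ] [LinearOrder α] [CommRing A]
    {β : ι → α} {M M₁ : Matrix ι κ A} {N N₁ : Matrix κ ι A} (h : (M * N).BlockTriangular β)
    (h₁ : (M₁ * N₁).BlockTriangular β) (h₂ : (M₁ * N).BlockTriangular β)
    (h₃ : (M * N₁).BlockTriangular β) (a b : A) :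
    ((a • M + b • M₁) * (a • N + b • N₁)).BlockTriangular β := by
  intro i j hij
  rw [Matrix.add_mul, Matrix.mul_add, Matrix.mul_add]
  simp [h hij, h₁ hij, h₂ hij, h₃ hij]

/-- Equations of a component hold along lines in the scheme through a generic point. -/
theorem point_eq_zero_of_line {P : Ideal (LUPolyRing m n)} (hP : P ∈ (idealE m n).minimalPrimes)
    {K : Type*} [Field K] [Algebra ℂ K] {X X₁ : Matrix (Fin m) (Fin n) K}
    {Y Y₁ : Matrix (Fin n) (Fin m) K} (hgen : ∀ r, point X Y r = 0 → r ∈ P) (h : OnE X Y)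
    (h₁ : OnE X₁ Y₁) (h₂ : OnE X₁ Y) (h₃ : OnE X Y₁) {r : LUPolyRing m n} (hr : r ∈ P) :
    point X₁ Y₁ r = 0 := by
  let t : Polynomial K := Polynomial.X
  let c : K →+* Polynomial K := Polynomial.C
  let Xt : Matrix (Fin m) (Fin n) (Polynomial K) := (1 - t) • X.map c + t • X₁.map c
  let Yt : Matrix (Fin n) (Fin m) (Polynomial K) := (1 - t) • Y.map c + t • Y₁.map c
  have hc : ∀ {k : ℕ} {β : Fin k → ℤ} {M : Matrix (Fin k) (Fin k) K}, M.BlockTriangular β →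
      (M.map c).BlockTriangular β := by
    intro k β M hM i j hij
    simp [hM hij]
  have hm : ∀ {k l : ℕ} {β : Fin k → ℤ} {M : Matrix (Fin k) (Fin l) K}
      {N : Matrix (Fin l) (Fin k) K}, (M * N).BlockTriangular β →
      (M.map c * N.map c).BlockTriangular β := by
    intro k l β M N hM
    rw [← Matrix.map_mul]
    exact hc hM
  have hE : OnE Xt Yt :=
    ⟨blockTriangular_combination (hm h.1) (hm h₁.1) (hm h₂.1) (hm h₃.1) _ _,
      blockTriangular_combination (hm h.2) (hm h₁.2) (hm h₃.2) (hm h₂.2) _ _⟩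
  have ev : ∀ (a : K), ∃ e : Polynomial K →ₐ[ℂ] K, ∀ q, e q = Polynomial.eval a q := fun a =>
    ⟨(Polynomial.aeval a).restrictScalars ℂ, fun q => by simp [Polynomial.coe_aeval_eq_eval]⟩
  obtain ⟨e₀, he₀⟩ := ev 0
  obtain ⟨e₁, he₁⟩ := ev 1
  have hX₀ : Xt.map e₀ = X := by ext; simp [Xt, he₀, t, c]
  have hY₀ : Yt.map e₀ = Y := by ext; simp [Yt, he₀, t, c]
  have hX₁ : Xt.map e₁ = X₁ := by ext; simp [Xt, he₁, t, c]
  have hY₁ : Yt.map e₁ = Y₁ := by ext; simp [Yt, he₁, t, c]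
  have h0 : point Xt Yt r = 0 := point_eq_zero_of_mem hP hE (fun r hr => hgen r (by
    rw [← hX₀, ← hY₀, ← comp_point, hr, map_zero])) hr
  rw [← hX₁, ← hY₁, ← comp_point, h0, map_zero]

/-- At the generic point of a component, `XY` has arbitrary diagonal specializations, so
that no relation on the diagonal entries of `XY` holds identically. -/
theorem exists_specialization_diag (hmn : m ≤ n) {P : Ideal (LUPolyRing m n)}
    (hP : P ∈ (idealE m n).minimalPrimes) (w : Fin m → ℂ) :
    ∃ (K : Type) (_ : Field K) (f : LUPolyRing m n →+* K),
      (∀ r ∈ P, f r = 0) ∧ ∀ i, f ((genX m n * genY m n) i i) = f (C (w i)) := by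
  have := hP.1.1
  let K := FractionRing (LUPolyRing m n ⧸ P)
  let g : LUPolyRing m n →ₐ[ℂ] K :=
    (IsScalarTower.toAlgHom ℂ (LUPolyRing m n ⧸ P) K).comp (Ideal.Quotient.mkₐ ℂ P)
  have hg : ∀ r, g r = 0 ↔ r ∈ P := by
    intro r
    simp only [g, AlgHom.comp_apply, Ideal.Quotient.mkₐ_eq_mk, IsScalarTower.coe_toAlgHom',
      FaithfulSMul.algebraMap_eq_zero_iff, Ideal.Quotient.eq_zero_iff_mem]
  set X := (genX m n).map g with hXdef
  set Y := (genY m n).map g with hYdef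
  have hgen : ∀ r, point X Y r = 0 → r ∈ P := fun r hr => by
    rwa [point_gen, hg] at hr
  have hE : OnE X Y := (idealE_le_ker_iff (g : LUPolyRing m n →+* K)).1 fun r hr =>
    (hg r).2 (hP.1.2 hr)
  have hc : Fintype.card (Fin m) ≤ Fintype.card (Fin n) := by simpa using hmn
  obtain ⟨Y₁, G, hY₁, hY₁', hG⟩ := exists_full_rank_partner hc (lowerIndex m) (upperIndex n) X
  obtain ⟨s, hs⟩ := exists_det_submatrix_ne_zero G Y₁ hG
  have hdet : (Y.submatrix s id).det ≠ 0 := by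
    intro h0
    apply hs
    have hmem : ((genY m n).submatrix s id).det ∈ P := by
      rw [← hg, AlgHom.map_det]
      exact h0
    have h1 := point_eq_zero_of_line hP hgen hE ⟨hY₁, hY₁'⟩ hE ⟨hY₁, hY₁'⟩ hmem
    rw [AlgHom.map_det] at h1
    rw [← h1]
    congr 1
    ext i j
    simp [point, genY]
  obtain ⟨Z, hZ, hZ', hZd⟩ := exists_partner_diag hc (upperIndex_injective m) (lowerIndex n) Yᵀ
    (fun v hv => by
      rw [vecMul_transpose] at hv
      by_contra hne
      refine hdet (exists_mulVec_eq_zero_iff.1 ⟨v, hne, ?_⟩)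
      ext i
      exact congrFun hv (s i)) (fun i => algebraMap ℂ K (w i))
  have hX₁ : OnE Zᵀ Y := by
    constructor
    · intro i i' hlt
      have : (Zᵀ * Y) i i' = (Yᵀ * Z) i' i := by
        rw [← transpose_apply (Zᵀ * Y), transpose_mul, transpose_transpose]
      rw [this]
      apply hZ
      simp only [lowerIndex, upperIndex] at *
      omega
    · intro i i' hlt
      have : (Y * Zᵀ) i i' = (Z * Yᵀ) i' i := by
        rw [← transpose_apply (Y * Zᵀ), transpose_mul, transpose_transpose]
      rw [this]
      apply hZ'
      simp only [lowerIndex, upperIndex] at *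
      omega
  refine ⟨K, inferInstance, (point Zᵀ Y : LUPolyRing m n →+* K),
    fun r hr => point_eq_zero_of_line hP hgen hE hX₁ hX₁ hE hr, fun i => ?_⟩
  have h1 : ((genX m n * genY m n).map (point Zᵀ Y)) i i = (Yᵀ * Z) i i := by
    rw [Matrix.map_mul, genX_map_point, genY_map_point, ← transpose_apply (Zᵀ * Y), transpose_mul,
      transpose_transpose]
  rw [hZd] at h1
  refine h1.trans ?_
  change _ = point Zᵀ Y (C (w i))
  rw [← MvPolynomial.algebraMap_eq, AlgHom.commutes]

theorem diag_notMem (hmn : m ≤ n) {P : Ideal (LUPolyRing m n)}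
    (hP : P ∈ (idealE m n).minimalPrimes) (i : Fin m) : (genX m n * genY m n) i i ∉ P := by
  intro h
  obtain ⟨K, _, f, hf, hw⟩ := exists_specialization_diag hmn hP 1
  have h1 := hf _ h
  rw [hw] at h1
  simp at h1

theorem diag_sub_diag_notMem (hmn : m ≤ n) {P : Ideal (LUPolyRing m n)}
    (hP : P ∈ (idealE m n).minimalPrimes) {i i' : Fin m} (hne : i ≠ i') :
    (genX m n * genY m n) i i - (genX m n * genY m n) i' i' ∉ P := by
  intro h
  obtain ⟨K, _, f, hf, hw⟩ := exists_specialization_diag hmn hP (Pi.single i 1)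
  have h1 := hf _ h
  rw [map_sub, hw, hw] at h1
  simp [Pi.single_eq_of_ne hne.symm] at h1

end Generic

section Local

variable {m n : ℕ}

theorem mul_mul_comm_pow {A : Type*} [CommRing A] (X : Matrix ι κ A) (Y : Matrix κ ι A) (k : ℕ) :
    (Y * X) ^ (k + 1) = Y * (X * Y) ^ k * X := by
  induction k with
  | zero => simp
  | succ k ih => rw [pow_succ, ih, pow_succ]; simp only [Matrix.mul_assoc]

theorem aeval_mul_comm {A : Type*} [CommRing A] (X : Matrix ι κ A) (Y : Matrix κ ι A)
    (p : Polynomial A) : Polynomial.aeval (Y * X) (Polynomial.X * p) =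
      Y * Polynomial.aeval (X * Y) p * X := by
  induction p using Polynomial.induction_on' with
  | add p q hp hq => rw [mul_add, map_add, hp, hq, map_add, Matrix.mul_add, Matrix.add_mul]
  | monomial k a =>
    rw [Polynomial.X_mul_monomial, Polynomial.aeval_monomial, Polynomial.aeval_monomial,
      ← Algebra.smul_def, ← Algebra.smul_def, mul_mul_comm_pow, Matrix.mul_smul, Matrix.smul_mul]

theorem exists_eq_of_prod_sub_eq_zero {A τ : Type*} [CommRing A] [IsLocalRing A] [Fintype τ]
    [DecidableEq τ] (r : τ → A) (hr : ∀ k l, k ≠ l → IsUnit (r k - r l)) {a : A}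
    (h : ∏ k, (a - r k) = 0) : ∃ k, a = r k := by
  obtain ⟨k, hk⟩ : ∃ k, ¬ IsUnit (a - r k) := by
    by_contra! hcon
    have := Finset.prod_induction (s := Finset.univ) (fun k => a - r k) IsUnit
      (fun _ _ => IsUnit.mul) isUnit_one (fun k _ => hcon k)
    rw [h] at this
    exact not_isUnit_zero this
  refine ⟨k, ?_⟩
  have hu : IsUnit (∏ l ∈ Finset.univ.erase k, (a - r l)) := by
    refine Finset.prod_induction _ IsUnit (fun _ _ => IsUnit.mul) isUnit_one fun l hl => ?_
    by_contra hl'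
    have h1 := IsLocalRing.nonunits_add (a := a - r l) (b := -(a - r k)) hl'
      (fun hn => hk ((IsUnit.neg_iff _).1 hn))
    apply h1
    convert hr k l (Finset.ne_of_mem_erase hl).symm using 1
    ring
  rw [← Finset.mul_prod_erase _ _ (Finset.mem_univ k), hu.mul_left_eq_zero, sub_eq_zero] at h
  exact h

/-- Over a local ring, a pair of matrices with generic diagonal products is equivalent, by
unipotent triangular matrices, to a pair of partial monomial matrices. -/
theorem exists_normal_form {A : Type*} [CommRing A] [IsLocalRing A]
    {X : Matrix (Fin m) (Fin n) A} {Y : Matrix (Fin n) (Fin m) A} (hE : OnE X Y)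
    (hu : ∀ i, IsUnit ((X * Y) i i))
    (hd : ∀ i i', i ≠ i' → IsUnit ((X * Y) i i - (X * Y) i' i')) :
    ∃ (f : Fin n → Option (Fin m)) (L : Matrix (Fin m) (Fin m) A) (U : Matrix (Fin n) (Fin n) A)
      (D : Matrix (Fin m) (Fin n) A) (D' : Matrix (Fin n) (Fin m) A),
      L.BlockTriangular (lowerIndex m) ∧ (∀ i, L i i = 1) ∧
      U.BlockTriangular (upperIndex n) ∧ (∀ j, U j j = 1) ∧
      (∀ i j j', f j = some i → f j' = some i → j = j') ∧
      (∀ i j, f j ≠ some i → D i j = 0 ∧ D' j i = 0) ∧ X * U = L * D ∧ Y * L = U * D' := by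
  let r : Option (Fin m) → A := fun k => k.elim 0 fun i => (X * Y) i i
  have hr : ∀ k l, k ≠ l → IsUnit (r k - r l) := by
    rintro (_ | i) (_ | i') h
    · exact absurd rfl h
    · simpa [r] using hu i'
    · simpa [r] using hu i
    · exact hd i i' fun h' => h (congrArg some h')
  have hq : ∏ k, (Polynomial.X - Polynomial.C (r k)) = Polynomial.X * (X * Y).charpoly := by
    rw [Fintype.prod_option, charpoly_eq_prod_diag (lowerIndex_injective m) hE.1]
    simp [r]
  have hXY : Polynomial.aeval (X * Y) (∏ k, (Polynomial.X - Polynomial.C (r k))) = 0 := by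
    rw [hq, map_mul, aeval_self_charpoly, mul_zero]
  have hYX : Polynomial.aeval (Y * X) (∏ k, (Polynomial.X - Polynomial.C (r k))) = 0 := by
    rw [hq, aeval_mul_comm, aeval_self_charpoly, Matrix.mul_zero, Matrix.zero_mul]
  have hf : ∀ j, ∃ k, (Y * X) j j = r k := fun j => by
    refine exists_eq_of_prod_sub_eq_zero r hr ?_
    have h := aeval_diag (upperIndex_injective n) hE.2
      (∏ k, (Polynomial.X - Polynomial.C (r k))) j
    rw [hYX, Polynomial.eval_prod] at h
    simpa using h.symm
  choose f hf using hf
  obtain ⟨L, hL, hL1, hXL⟩ := exists_triangular_eigenbasis (lowerIndex_injective m) hE.1 r hr hXY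
    some fun i => rfl
  obtain ⟨U, hU, hU1, hYU⟩ := exists_triangular_eigenbasis (upperIndex_injective n) hE.2 r hr hYX
    f hf
  obtain ⟨L', -, hLL⟩ := exists_triangular_inverse (lowerIndex_injective m) hL hL1
  obtain ⟨U', -, hUU⟩ := exists_triangular_inverse (upperIndex_injective n) hU hU1
  set Λ : Matrix (Fin m) (Fin m) A := diagonal fun i => r (some i)
  set Mu : Matrix (Fin n) (Fin n) A := diagonal fun j => r (f j) with hMu
  have cL : ∀ {k : ℕ} {B C : Matrix (Fin m) (Fin k) A}, L * B = L * C → B = C := by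
    intro k B C h
    have := congrArg (L' * ·) h
    simpa [← Matrix.mul_assoc, mul_eq_one_comm.1 hLL] using this
  have cU : ∀ {k : ℕ} {B C : Matrix (Fin n) (Fin k) A}, U * B = U * C → B = C := by
    intro k B C h
    have := congrArg (U' * ·) h
    simpa [← Matrix.mul_assoc, mul_eq_one_comm.1 hUU] using this
  set D := L' * (X * U) with hD
  set D' := U' * (Y * L) with hD'
  have h1 : X * U = L * D := by rw [hD, ← Matrix.mul_assoc L, hLL, Matrix.one_mul]
  have h2 : Y * L = U * D' := by rw [hD', ← Matrix.mul_assoc U, hUU, Matrix.one_mul]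
  clear_value D D'
  have e1 : Λ * D = D * Mu := cL <| by
    rw [← Matrix.mul_assoc, ← hXL, Matrix.mul_assoc, ← h1, ← Matrix.mul_assoc L, ← h1,
      Matrix.mul_assoc X U, ← hYU]
    simp only [Matrix.mul_assoc]
  have e2 : Mu * D' = D' * Λ := cU <| by
    rw [← Matrix.mul_assoc, ← hYU, Matrix.mul_assoc, ← h2, ← Matrix.mul_assoc U, ← h2,
      Matrix.mul_assoc Y L, ← hXL]
    simp only [Matrix.mul_assoc]
  have e3 : D' * D = Mu := cU <| by
    rw [← Matrix.mul_assoc, ← h2, Matrix.mul_assoc, ← h1, ← hYU, Matrix.mul_assoc]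
  have hz : ∀ i j, f j ≠ some i → D i j = 0 ∧ D' j i = 0 := by
    intro i j hij
    have hunit := hr _ _ hij
    have c1 := congrFun (congrFun e1 i) j
    have c2 := congrFun (congrFun e2 j) i
    rw [diagonal_mul, mul_diagonal] at c1 c2
    constructor
    · rw [← hunit.mul_right_eq_zero, sub_mul, c1]
      ring
    · rw [← hunit.mul_right_eq_zero, sub_mul, c2]
      ring
  have hs : ∀ i j j', f j = some i → Mu j j' = D' j i * D i j' := by
    intro i j j' hj
    rw [← e3, mul_apply]
    refine Finset.sum_eq_single i (fun k _ hk => ?_) (by simp)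
    rw [(hz k j (by rw [hj]; exact fun h => hk (Option.some.inj h).symm)).2, zero_mul]
  refine ⟨f, L, U, D, D', hL, hL1, hU, hU1, fun i j j' hj hj' => ?_, hz, h1, h2⟩
  by_contra hne
  have u1 : IsUnit (D' j i * D i j) := by
    rw [← hs i j j hj, hMu, diagonal_apply_eq, hj]
    exact hu i
  have u2 : IsUnit (D' j' i * D i j') := by
    rw [← hs i j' j' hj', hMu, diagonal_apply_eq, hj']
    exact hu i
  have h0 := hs i j j' hj
  rw [hMu, diagonal_apply_ne _ hne] at h0
  have := (isUnit_of_mul_isUnit_left u1).mul (isUnit_of_mul_isUnit_right u2)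
  rw [← h0] at this
  exact not_isUnit_zero this

end Local

section Family

open MvPolynomial

variable {m n : ℕ}

/-- The triangular matrix with ones on the diagonal and the given remaining entries. -/
def unipotent {A : Type*} [CommRing A] (β : ι → ℤ) (v : ι → ι → A) : Matrix ι ι A :=
  of fun i j => if i = j then 1 else if β j < β i then 0 else v i j

theorem unipotent_blockTriangular {A : Type*} [CommRing A] (β : ι → ℤ) (v : ι → ι → A) :
    (unipotent β v).BlockTriangular β := by
  intro i j hij
  have : i ≠ j := by rintro rfl; exact lt_irrefl _ hij
  simp [unipotent, this, hij]

theorem unipotent_diag {A : Type*} [CommRing A] (β : ι → ℤ) (v : ι → ι → A) (i : ι) :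
    unipotent β v i i = 1 := by
  simp [unipotent]

theorem unipotent_map {A B : Type*} [CommRing A] [CommRing B] [Algebra ℂ A] [Algebra ℂ B]
    {β : ι → ℤ} (v : ι → ι → A) (g : A →ₐ[ℂ] B) {L : Matrix ι ι B} (hL : L.BlockTriangular β)
    (hL1 : ∀ i, L i i = 1) (h : ∀ i j, g (v i j) = L i j) : (unipotent β v).map g = L := by
  ext i j
  by_cases hij : i = j
  · subst hij
    simp [unipotent, hL1]
  · by_cases hlt : β j < β i
    · simp [unipotent, hij, hlt, hL hlt]
    · simp [unipotent, hij, hlt, h]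

/-- The normal forms of a given combinatorial type form an irreducible family inside the
lower-upper scheme. -/
theorem exists_family (f : Fin n → Option (Fin m))
    (hf : ∀ i j j', f j = some i → f j' = some i → j = j') :
    ∃ (S : Type) (_ : CommRing S) (_ : IsDomain S) (_ : Algebra ℂ S)
      (Xs : Matrix (Fin m) (Fin n) S) (Ys : Matrix (Fin n) (Fin m) S), OnE Xs Ys ∧
      ∀ {A : Type} [CommRing A] [Algebra ℂ A] (X : Matrix (Fin m) (Fin n) A)
        (Y : Matrix (Fin n) (Fin m) A) (L : Matrix (Fin m) (Fin m) A)
        (U : Matrix (Fin n) (Fin n) A) (D : Matrix (Fin m) (Fin n) A)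
        (D' : Matrix (Fin n) (Fin m) A),
        L.BlockTriangular (lowerIndex m) → (∀ i, L i i = 1) →
        U.BlockTriangular (upperIndex n) → (∀ j, U j j = 1) →
        (∀ i j, f j ≠ some i → D i j = 0 ∧ D' j i = 0) → X * U = L * D → Y * L = U * D' →
        ∃ g : S →ₐ[ℂ] A, Xs.map g = X ∧ Ys.map g = Y := by
  let σ := (Fin m × Fin m) ⊕ (Fin n × Fin n) ⊕ (Fin m × Fin n) ⊕ (Fin n × Fin m)
  let S := MvPolynomial σ ℂ
  let L : Matrix (Fin m) (Fin m) S := unipotent (lowerIndex m) fun i j => X (Sum.inl (i, j))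
  let U : Matrix (Fin n) (Fin n) S :=
    unipotent (upperIndex n) fun i j => X (Sum.inr (Sum.inl (i, j)))
  let D : Matrix (Fin m) (Fin n) S :=
    of fun i j => if f j = some i then X (Sum.inr (Sum.inr (Sum.inl (i, j)))) else 0
  let D' : Matrix (Fin n) (Fin m) S :=
    of fun j i => if f j = some i then X (Sum.inr (Sum.inr (Sum.inr (j, i)))) else 0
  have hL : L.BlockTriangular (lowerIndex m) := unipotent_blockTriangular _ _
  have hU : U.BlockTriangular (upperIndex n) := unipotent_blockTriangular _ _
  obtain ⟨L', hL', hLL⟩ := exists_triangular_inverse (lowerIndex_injective m) hL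
    (unipotent_diag _ _)
  obtain ⟨U', hU', hUU⟩ := exists_triangular_inverse (upperIndex_injective n) hU
    (unipotent_diag _ _)
  have hDD : (D * D').BlockTriangular (lowerIndex m) := by
    intro i i' hlt
    rw [mul_apply]
    refine Finset.sum_eq_zero fun j _ => ?_
    by_cases h : f j = some i
    · have : f j ≠ some i' := by
        rw [h]
        intro h'
        rw [Option.some.inj h'] at hlt
        exact lt_irrefl _ hlt
      simp [D', this]
    · simp [D, h]
  have hDD' : (D' * D).BlockTriangular (upperIndex n) := by
    intro j j' hlt
    rw [mul_apply]
    refine Finset.sum_eq_zero fun i _ => ?_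
    by_cases h : f j = some i
    · have : f j' ≠ some i := by
        intro h'
        rw [hf i j j' h h'] at hlt
        exact lt_irrefl _ hlt
      simp [D, this]
    · simp [D', h]
  refine ⟨S, inferInstance, inferInstance, inferInstance, L * D * U', U * D' * L', ⟨?_, ?_⟩, ?_⟩
  · rw [mul_conj_mul (mul_eq_one_comm.1 hUU)]
    exact (hL.mul hDD).mul hL'
  · rw [mul_conj_mul (mul_eq_one_comm.1 hLL)]
    exact (hU.mul hDD').mul hU'
  · intro A _ _ X₁ Y₁ L₁ U₁ D₁ D₁' hL₁ hL1 hU₁ hU1 hz hX hY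
    let g : S →ₐ[ℂ] A := aeval (Sum.elim (fun p => L₁ p.1 p.2) (Sum.elim (fun p => U₁ p.1 p.2)
      (Sum.elim (fun p => D₁ p.1 p.2) (fun p => D₁' p.1 p.2))))
    have gL : L.map g = L₁ := unipotent_map _ _ hL₁ hL1 fun i j => aeval_X _ _
    have gU : U.map g = U₁ := unipotent_map _ _ hU₁ hU1 fun i j => aeval_X _ _
    have gD : D.map g = D₁ := by
      ext i j
      by_cases h : f j = some i
      · simp only [D, map_apply, of_apply, if_pos h]
        exact aeval_X _ _
      · simp [D, h, (hz i j h).1]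
    have gD' : D'.map g = D₁' := by
      ext j i
      by_cases h : f j = some i
      · simp only [D', map_apply, of_apply, if_pos h]
        exact aeval_X _ _
      · simp [D', h, (hz i j h).2]
    have gLL : L₁ * L'.map g = 1 := by
      rw [← gL, ← Matrix.map_mul, hLL, Matrix.map_one _ (map_zero g) (map_one g)]
    have gUU : U₁ * U'.map g = 1 := by
      rw [← gU, ← Matrix.map_mul, hUU, Matrix.map_one _ (map_zero g) (map_one g)]
    refine ⟨g, ?_, ?_⟩
    · rw [Matrix.map_mul, Matrix.map_mul, gL, gD, ← hX, Matrix.mul_assoc, gUU, Matrix.mul_one]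
    · rw [Matrix.map_mul, Matrix.map_mul, gU, gD', ← hY, Matrix.mul_assoc, gLL, Matrix.mul_one]

/-- The equations of a component hold on the local scheme at its generic point. -/
theorem eq_zero_of_mem_minimalPrime (hmn : m ≤ n) {P : Ideal (LUPolyRing m n)}
    (hP : P ∈ (idealE m n).minimalPrimes) {A : Type} [CommRing A] [IsLocalRing A]
    (h : LUPolyRing m n →+* A) (hE : idealE m n ≤ RingHom.ker h)
    (hu : ∀ r, r ∉ P ↔ IsUnit (h r)) {r : LUPolyRing m n} (hr : r ∈ P) : h r = 0 := by
  let _ : Algebra ℂ A := (h.comp C).toAlgebra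
  let h' : LUPolyRing m n →ₐ[ℂ] A := { h with commutes' := fun _ => rfl }
  set X := (genX m n).map h' with hX
  set Y := (genY m n).map h' with hY
  have hOn : OnE X Y := (idealE_le_ker_iff h).1 hE
  have hXY : ∀ i, (X * Y) i i = h ((genX m n * genY m n) i i) := fun i => by
    rw [hX, hY, ← Matrix.map_mul]
    rfl
  obtain ⟨f, L, U, D, D', hL, hL1, hU, hU1, hf, hz, h1, h2⟩ := exists_normal_form hOn
    (fun i => by rw [hXY]; exact (hu _).1 (diag_notMem hmn hP i))
    (fun i i' hne => by rw [hXY, hXY, ← map_sub]; exact (hu _).1 (diag_sub_diag_notMem hmn hP hne))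
  obtain ⟨S, _, _, _, Xs, Ys, hs, hfam⟩ := exists_family f hf
  obtain ⟨g, hgX, hgY⟩ := hfam X Y L U D D' hL hL1 hU hU1 hz h1 h2
  have hg : ∀ r, g (point Xs Ys r) = h r := fun r => by
    rw [comp_point, hgX, hgY, hX, hY, point_gen]
    rfl
  rw [← hg, point_eq_zero_of_mem hP hs (fun r hr => ?_) hr, map_zero]
  by_contra hrP
  have := (hu r).1 hrP
  rw [← hg, hr, map_zero] at this
  exact not_isUnit_zero this

end Family

theorem isReduced_of_isLocalization {R : Type*} [CommRing R] (M : Submonoid R) (A : Type*)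
    [CommRing A] [Algebra R A] [IsLocalization M A]
    (h : ∀ a, IsNilpotent (algebraMap R A a) → algebraMap R A a = 0) : IsReduced A := by
  refine ⟨fun x hx => ?_⟩
  obtain ⟨a, s, rfl⟩ := IsLocalization.exists_mk'_eq M x
  have hspec := IsLocalization.mk'_spec A a s
  have h0 : algebraMap R A a = 0 := h a <| by
    obtain ⟨k, hk⟩ := hx
    exact ⟨k, by rw [← hspec, mul_pow, hk, zero_mul]⟩
  rwa [h0, (IsLocalization.map_units A s).mul_left_eq_zero] at hspec

theorem isReduced_of_isLocalization_atPrime {m n : ℕ} (hmn : m ≤ n) {P : Ideal (LUPolyRing m n)}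
    (hP : P ∈ (idealE m n).minimalPrimes) (Q : Ideal (LUPolyRing m n ⧸ idealE m n)) [Q.IsPrime]
    (hQ : ∀ r, Ideal.Quotient.mk (idealE m n) r ∈ Q ↔ r ∈ P) (A : Type) [CommRing A]
    [Algebra (LUPolyRing m n ⧸ idealE m n) A] [IsLocalization.AtPrime A Q] : IsReduced A := by
  have := IsLocalization.AtPrime.isLocalRing A Q
  refine isReduced_of_isLocalization Q.primeCompl A fun a ha => ?_
  obtain ⟨r, rfl⟩ := Ideal.Quotient.mk_surjective a
  have hu : ∀ r, r ∉ P ↔ IsUnit (algebraMap _ A (Ideal.Quotient.mk (idealE m n) r)) := fun r => by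
    rw [← hQ]
    exact (IsLocalization.AtPrime.isUnit_to_map_iff A Q _).symm
  refine eq_zero_of_mem_minimalPrime hmn hP
    ((algebraMap _ A).comp (Ideal.Quotient.mk (idealE m n))) (fun r hr => ?_) hu ?_
  · rw [RingHom.mem_ker, RingHom.comp_apply, Ideal.Quotient.eq_zero_iff_mem.2 hr, map_zero]
  · by_contra hr
    exact ((hu r).1 hr).not_isNilpotent ha

end LowerUpper

/-- The lower-upper scheme is generically reduced: the localization of `R/I_E` at any
minimal prime over `I_E` is reduced. -/
theorem lowerUpper_genericallyReduced (m n : ℕ) (hm : 1 ≤ m) (hmn : m ≤ n)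
    (P : Ideal (LUPolyRing m n)) (hP : P ∈ (idealE m n).minimalPrimes)
    (hQ : (P.map (Ideal.Quotient.mk (idealE m n))).IsPrime) :
    IsReduced (Localization
      (@Ideal.primeCompl _ _ (P.map (Ideal.Quotient.mk (idealE m n))) hQ)) := by
  exact LowerUpper.isReduced_of_isLocalization_atPrime hmn hP
    (P.map (Ideal.Quotient.mk (idealE m n))) (fun _ => Ideal.mem_quotient_iff_mem hP.1.2)
    (Localization (@Ideal.primeCompl _ _ (P.map (Ideal.Quotient.mk (idealE m n))) hQ))
end

section
/- The lower-upper scheme is equidimensional of dimension m(n+1): for every minimal prime P of R lying over the ideal I_E, the Krull dimension of the quotient ring R/P equals m(n+1). -/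
theorem ringKrullDim_eq_of_isIntegral (R S : Type*) [CommRing R] [CommRing S] [Algebra R S]
    [Algebra.IsIntegral R S] [FaithfulSMul R S] : ringKrullDim S = ringKrullDim R := by
  apply le_antisymm
  · exact Order.krullDim_le_of_strictMono (PrimeSpectrum.comap (algebraMap R S))
      fun I J h => Ideal.IsIntegral.comap_lt_comap (I := I.asIdeal) (J := J.asIdeal) h
  · refine iSup_le fun l => ?_
    obtain ⟨P, hP, hlo⟩ := (inferInstance : Nonempty ((RelSeries.head l).asIdeal.primesOver S))
    obtain ⟨L, hL, -, -⟩ := Ideal.exists_ltSeries_of_hasGoingUp l P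
    rw [← hL]
    exact Order.LTSeries.length_le_krullDim L

/-- In characteristic zero, the dimension of an affine domain is the number of independent
derivations of its fraction field. -/
theorem ringKrullDim_eq_finrank_derivation (k A K : Type*) [Field k] [CharZero k] [CommRing A]
    [IsDomain A] [Algebra k A] [Algebra.FiniteType k A] [Field K] [Algebra A K]
    [IsFractionRing A K] [Algebra k K] [IsScalarTower k A K] :
    Module.Finite K (Derivation k K K) ∧
      ringKrullDim A = (Module.finrank K (Derivation k K K) : ℕ) := by
  obtain ⟨d, g, hg, hint⟩ := exists_integral_inj_algHom_of_fg k A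
  let S := MvPolynomial (Fin d) k
  let : Algebra S A := g.toRingHom.toAlgebra
  have : IsScalarTower k S A := IsScalarTower.of_algebraMap_eq' g.comp_algebraMap.symm
  have : Algebra.IsIntegral S A := ⟨hint⟩
  have hSA : Function.Injective (algebraMap S A) := hg
  have : FaithfulSMul S A := (faithfulSMul_iff_algebraMap_injective S A).2 hg
  let : Algebra S K := ((algebraMap A K).comp (algebraMap S A)).toAlgebra
  have : IsScalarTower S A K := IsScalarTower.of_algebraMap_eq' rfl
  have : IsScalarTower k S K := by
    refine IsScalarTower.of_algebraMap_eq' ?_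
    rw [IsScalarTower.algebraMap_eq S A K, RingHom.comp_assoc, ← IsScalarTower.algebraMap_eq k S A,
      ← IsScalarTower.algebraMap_eq]
  have hSK : FaithfulSMul S K := (faithfulSMul_iff_algebraMap_injective S K).2 <|
    (IsFractionRing.injective A K).comp hg
  let F := FractionRing S
  let : Algebra F K := FractionRing.liftAlgebra S K
  have : IsScalarTower S F K := FractionRing.isScalarTower_liftAlgebra S K
  have : Algebra.IsAlgebraic S K := by
    have : Algebra.IsAlgebraic A K := IsLocalization.isAlgebraic K (nonZeroDivisors A)
    exact Algebra.IsAlgebraic.trans S A K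
  have : Algebra.IsAlgebraic F K := (IsFractionRing.comap_isAlgebraic_iff (A := S)).1 this
  have : CharZero F := charZero_of_injective_algebraMap (algebraMap k F).injective
  have : Algebra.FormallyEtale F K := Algebra.FormallyEtale.of_isSeparable F K
  have : Algebra.FormallyEtale S F := Algebra.FormallyEtale.of_isLocalization (nonZeroDivisors S)
  have : Algebra.FormallyEtale S K := Algebra.FormallyEtale.comp S F K
  let b := ((Algebra.TensorProduct.basis K
    (KaehlerDifferential.mvPolynomialBasis k (Fin d))).map
      (KaehlerDifferential.tensorKaehlerEquivOfFormallyEtale k S K))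
  let e := b.dualBasis.map (KaehlerDifferential.linearMapEquivDerivation k K)
  refine ⟨Module.Finite.of_basis e, ?_⟩
  rw [Module.finrank_eq_card_basis e, ringKrullDim_eq_of_isIntegral S A,
    MvPolynomial.ringKrullDim_of_isNoetherianRing, ringKrullDim_eq_zero_of_field]
  simp

section LowerUpper

open Matrix

/-- A matrix with at most one nonzero entry in each row and in each column. -/
def Matrix.IsPartialMonomial {ι κ K : Type*} [Zero K] (N : Matrix ι κ K) : Prop :=
  ∀ i j, N i j ≠ 0 → (∀ j', j' ≠ j → N i j' = 0) ∧ ∀ i', i' ≠ i → N i' j = 0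

/-- Gaussian elimination that only adds rows to later rows and columns to later columns. -/
theorem Matrix.exists_lower_mul_mul_upper_isPartialMonomial {K : Type*} [Field K] {p q : ℕ}
    (M : Matrix (Fin p) (Fin q) K) :
    ∃ (A : Matrix (Fin p) (Fin p) K) (B : Matrix (Fin q) (Fin q) K),
      A.IsLowerTriangular ∧ IsUnit A ∧ B.IsUpperTriangular ∧ IsUnit B ∧
        (A * M * B).IsPartialMonomial := by
  suffices h : ∀ k ≤ p, ∃ (A : Matrix (Fin p) (Fin p) K) (B : Matrix (Fin q) (Fin q) K),
      A.IsLowerTriangular ∧ IsUnit A ∧ B.IsUpperTriangular ∧ IsUnit B ∧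
        ∀ i : Fin p, (i : ℕ) < k → ∀ j, (A * M * B) i j ≠ 0 →
          (∀ j', j' ≠ j → (A * M * B) i j' = 0) ∧ ∀ i', i' ≠ i → (A * M * B) i' j = 0 by
    obtain ⟨A, B, hA, hA', hB, hB', h⟩ := h p le_rfl
    exact ⟨A, B, hA, hA', hB, hB', fun i j => h i i.2 j⟩
  intro k
  induction k with
  | zero =>
    exact fun _ => ⟨1, 1, blockTriangular_one, isUnit_one, blockTriangular_one, isUnit_one, by simp⟩
  | succ k ih =>
    intro hk
    obtain ⟨A, B, hA, hA', hB, hB', h⟩ := ih (by lia)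
    set N := A * M * B with hN
    let r : Fin p := ⟨k, hk⟩
    by_cases hr : ∀ j, N r j = 0
    · refine ⟨A, B, hA, hA', hB, hB', fun i hi j hij => ?_⟩
      rcases Nat.lt_succ_iff_lt_or_eq.1 hi with hi | hi
      · exact h i hi j hij
      · exact absurd (hr j) (by rwa [show r = i from Fin.ext hi.symm])
    push Not at hr
    obtain ⟨c, hc, hmin⟩ := WellFounded.has_min (wellFounded_lt (α := Fin q)) {j | N r j ≠ 0} hr
    replace hc : N r c ≠ 0 := hc
    replace hmin : ∀ j < c, N r j = 0 := fun j hj => by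
      by_contra h0; exact hmin j h0 hj
    let u : Fin p → K := fun a => if r < a then -(N a c / N r c) else 0
    let v : Fin q → K := fun b => if c < b then -(N r b / N r c) else 0
    let A₁ : Matrix (Fin p) (Fin p) K := 1 + vecMulVec u (Pi.single r 1)
    let B₁ : Matrix (Fin q) (Fin q) K := 1 + vecMulVec (Pi.single c 1) v
    have hAl : A₁.IsLowerTriangular := by
      intro i j hij
      replace hij : i < j := hij
      simp only [A₁, add_apply, one_apply_ne hij.ne, vecMulVec_apply, u, Pi.single_apply, zero_add]
      grind
    have hBu : B₁.IsUpperTriangular := by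
      intro i j hij
      replace hij : j < i := hij
      simp only [B₁, add_apply, one_apply_ne hij.ne', vecMulVec_apply, v, Pi.single_apply, zero_add]
      grind
    have hAu : IsUnit A₁ := by
      rw [isUnit_iff_isUnit_det, det_of_isLowerTriangular _ hAl, Finset.prod_eq_one]
      · exact isUnit_one
      · intro i _
        simp only [A₁, add_apply, one_apply_eq, vecMulVec_apply, u, Pi.single_apply]
        grind
    have hBu' : IsUnit B₁ := by
      rw [isUnit_iff_isUnit_det, det_of_isUpperTriangular hBu, Finset.prod_eq_one]
      · exact isUnit_one
      · intro i _
        simp only [B₁, add_apply, one_apply_eq, vecMulVec_apply, v, Pi.single_apply]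
        grind
    refine ⟨A₁ * A, B * B₁,
      hAl.mul hA, hAu.mul hA', hB.mul hBu, hB'.mul hBu', ?_⟩
    have key : ∀ a b, (A₁ * A * M *
        (B * B₁)) a b =
          N a b + u a * N r b + (N a c + u a * N r c) * v b := by
      intro a b
      have e : A₁ * A * M * (B * B₁) = A₁ * N * B₁ := by simp only [hN, Matrix.mul_assoc]
      have e₁ : ∀ b, (A₁ * N) a b = N a b + u a * N r b := fun b => by
        simp [A₁, Matrix.add_mul, vecMulVec_mul, vecMulVec_apply]
      rw [e, ← e₁, ← e₁]
      simp [B₁, Matrix.mul_add, mul_vecMulVec, vecMulVec_apply]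
    simp only [key]
    have hlt : ∀ a, a < r → ∀ b, N a b ≠ 0 → N r b = 0 := fun a ha b hab =>
      (h a ha b hab).2 r ha.ne'
    have e1 : ∀ a, a < r → ∀ b, N a b + u a * N r b + (N a c + u a * N r c) * v b = N a b := by
      intro a ha b
      have : N a c = 0 := by by_contra h0; exact hc (hlt a ha c h0)
      simp [u, ha.not_gt, this]
    have e2 : ∀ b, N r b + u r * N r b + (N r c + u r * N r c) * v b =
        if b = c then N r c else 0 := by
      intro b
      simp only [u, lt_irrefl, if_false, zero_mul, add_zero, v]
      rcases lt_trichotomy b c with hb | hb | hb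
      · simp [hb.not_gt, hb.ne, hmin b hb]
      · simp [hb]
      · simp only [hb, if_true, hb.ne', if_false]; field_simp; ring
    have e3 : ∀ a, r < a → ∀ b, N a b + u a * N r b + (N a c + u a * N r c) * v b =
        N a b - N a c / N r c * N r b := by
      intro a ha b
      simp only [u, ha, if_true]
      field_simp
      ring
    intro i hi j hij
    rcases Nat.lt_succ_iff_lt_or_eq.1 hi with hi | hi
    · have hir : i < r := hi
      rw [e1 i hir] at hij
      have hrj := hlt i hir j hij
      obtain ⟨h1, h2⟩ := h i hi j hij
      refine ⟨fun j' hj' => by rw [e1 i hir]; exact h1 j' hj', fun i' hi' => ?_⟩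
      rcases lt_trichotomy i' r with hb | hb | hb
      · rw [e1 i' hb]; exact h2 i' hi'
      · subst hb; rw [e2, if_neg]; rintro rfl; exact hc hrj
      · rw [e3 i' hb, hrj, h2 i' hi']; simp
    · obtain rfl : i = r := Fin.ext hi
      rw [e2] at hij
      obtain rfl : j = c := by by_contra h0; simp [h0] at hij
      refine ⟨fun j' hj' => by rw [e2, if_neg hj'], fun i' hi' => ?_⟩
      rcases lt_trichotomy i' r with hb | hb | hb
      · rw [e1 i' hb]; by_contra h0; exact hc (hlt i' hb j h0)
      · exact absurd hb hi'
      · rw [e3 i' hb]; field_simp; ring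

theorem Matrix.BlockTriangular.inv_of_isUnit {ι α R : Type*} [Fintype ι] [DecidableEq ι]
    [LinearOrder α] [CommRing R] {b : ι → α} {M : Matrix ι ι R} (hM : M.BlockTriangular b)
    (h : IsUnit M) : M⁻¹.BlockTriangular b := by
  let := h.invertible
  exact blockTriangular_inv_of_blockTriangular hM

/-- Gaussian elimination that only adds rows to earlier rows and columns to earlier columns. -/
theorem Matrix.exists_upper_mul_mul_lower_isPartialMonomial {K : Type*} [Field K] {p q : ℕ}
    (M : Matrix (Fin p) (Fin q) K) :
    ∃ (A : Matrix (Fin p) (Fin p) K) (B : Matrix (Fin q) (Fin q) K),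
      A.IsUpperTriangular ∧ IsUnit A ∧ B.IsLowerTriangular ∧ IsUnit B ∧
        (A * M * B).IsPartialMonomial := by
  obtain ⟨A, B, hA, hA', hB, hB', h⟩ :=
    exists_lower_mul_mul_upper_isPartialMonomial (M.submatrix Fin.rev Fin.rev)
  refine ⟨A.submatrix Fin.rev Fin.rev, B.submatrix Fin.rev Fin.rev,
    fun i j hij => hA (Fin.rev_lt_rev.2 hij), ?_, fun i j hij => hB (Fin.rev_lt_rev.2 hij), ?_, ?_⟩
  · exact (isUnit_submatrix_equiv Fin.revPerm Fin.revPerm).2 hA'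
  · exact (isUnit_submatrix_equiv Fin.revPerm Fin.revPerm).2 hB'
  · have e : A.submatrix Fin.rev Fin.rev * M * B.submatrix Fin.rev Fin.rev =
        (A * M.submatrix Fin.rev Fin.rev * B).submatrix Fin.revPerm Fin.revPerm := by
      rw [← submatrix_mul_equiv _ _ _ Fin.revPerm, ← submatrix_mul_equiv _ _ _ Fin.revPerm]
      congr 2
      ext i j
      simp
    rw [e]
    intro i j hij
    obtain ⟨h1, h2⟩ := h _ _ hij
    exact ⟨fun j' hj' => h1 _ (by simpa using hj'), fun i' hi' => h2 _ (by simpa using hi')⟩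

/-- The `0/1` matrix with a single one in each row, in the column prescribed by `σ`. -/
def Matrix.selection {ι κ : Type*} (K : Type*) [Zero K] [One K] [DecidableEq κ] (σ : ι → κ) :
    Matrix ι κ K :=
  of fun i j => if j = σ i then 1 else 0

theorem Matrix.selection_mul_transpose {ι κ K : Type*} [Field K] [Fintype κ]
    [DecidableEq ι] [DecidableEq κ] {σ : ι → κ} (hσ : σ.Injective) :
    selection K σ * (selection K σ)ᵀ = 1 := by
  ext i i'
  simp [selection, mul_apply, one_apply, hσ.eq_iff, eq_comm]

/-- Every matrix `y` has a partner `z` of full row rank such that `(z, y)` satisfies the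
lower-upper equations. -/
theorem Matrix.exists_lower_upper_partner {K : Type*} [Field K] {m n : ℕ} (hmn : m ≤ n)
    (y : Matrix (Fin n) (Fin m) K) :
    ∃ (z : Matrix (Fin m) (Fin n) K) (z' : Matrix (Fin n) (Fin m) K),
      z * z' = 1 ∧ (z * y).IsLowerTriangular ∧ (y * z).IsUpperTriangular := by
  obtain ⟨U, L, hU, hU', hL, hL', hN⟩ := exists_upper_mul_mul_lower_isPartialMonomial y
  set N := U * y * L with hNdef
  have hy : y = U⁻¹ * N * L⁻¹ := by
    have := hU'.invertible
    have := hL'.invertible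
    simp [hNdef, Matrix.mul_assoc]
  classical
  let s : Finset (Fin m) := Finset.univ.filter fun i => ∃ j, N j i ≠ 0
  have hs : ∀ i ∈ s, ∃ j, N j i ≠ 0 := fun i hi => by simpa [s] using hi
  have : ∃ f : Fin m → Fin n, ∀ i ∈ s, N (f i) i ≠ 0 :=
    ⟨fun i => if h : i ∈ s then (hs i h).choose else Fin.castLE hmn i, fun i hi => by
      simpa [hi] using (hs i hi).choose_spec⟩
  obtain ⟨f, hf⟩ := this
  have hinj : Set.InjOn f s := by
    intro i hi i' hi' hii
    by_contra hne
    exact hf i hi (by rw [hii]; exact (hN _ _ (hf i' hi')).1 i hne)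
  obtain ⟨t, ht, htc⟩ := Finset.exists_superset_card_eq (s := s.image f) (n := m)
    (Finset.card_image_le.trans (by simpa using s.card_le_univ)) (by simpa using hmn)
  obtain ⟨g, hg⟩ := Finset.exists_equiv_extend_of_card_eq (t := t) (by simp [htc]) ht hinj
  let σ : Fin m → Fin n := fun i => g i
  have hσ : σ.Injective := Subtype.val_injective.comp g.injective
  have hNσ : ∀ j i, j ≠ σ i → N j i = 0 := by
    intro j i hji
    by_contra h0
    have hi : i ∈ s := by simpa [s] using ⟨j, h0⟩
    refine hf i hi ((hN _ _ h0).2 _ ?_)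
    rintro rfl
    exact hji (hg i hi).symm
  have h1 : (selection K σ * N).IsLowerTriangular := by
    intro i i' hii
    rw [mul_apply, Finset.sum_eq_zero]
    intro j _
    by_cases hj : j = σ i
    · rw [hNσ j i', mul_zero]
      rintro rfl
      exact (ne_of_gt (OrderDual.toDual_lt_toDual.1 hii)) (hσ hj)
    · simp [selection, hj]
  have h2 : (N * selection K σ).IsUpperTriangular := by
    intro j j' hjj
    rw [mul_apply, Finset.sum_eq_zero]
    intro i _
    by_cases hj : j' = σ i
    · rw [hNσ j i, zero_mul]
      rintro rfl
      exact hjj.ne hj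
    · simp [selection, hj]
  refine ⟨L * selection K σ * U, U⁻¹ * (selection K σ)ᵀ * L⁻¹, ?_, ?_, ?_⟩
  · have := hU'.invertible
    have := hL'.invertible
    calc L * selection K σ * U * (U⁻¹ * (selection K σ)ᵀ * L⁻¹)
        = L * (selection K σ * (selection K σ)ᵀ) * L⁻¹ := by simp [Matrix.mul_assoc]
      _ = 1 := by simp [selection_mul_transpose hσ]
  · have := hU'.invertible
    have : L * selection K σ * U * y = L * (selection K σ * N) * L⁻¹ := by
      rw [hy]; simp [Matrix.mul_assoc]
    rw [this]
    exact (hL.mul h1).mul (hL.inv_of_isUnit hL')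
  · have := hL'.invertible
    have : y * (L * selection K σ * U) = U⁻¹ * (N * selection K σ) * U := by
      rw [hy]; simp [Matrix.mul_assoc]
    rw [this]
    exact ((hU.inv_of_isUnit hU').mul h2).mul hU

/-- Bruhat decomposition of a matrix of full row rank. -/
theorem Matrix.exists_eq_lower_mul_selection_mul_upper {K : Type*} [Field K] {m n : ℕ}
    (x : Matrix (Fin m) (Fin n) K) (hx : ∀ v, v ᵥ* x = 0 → v = 0) :
    ∃ (L : Matrix (Fin m) (Fin m) K) (U : Matrix (Fin n) (Fin n) K) (σ : Fin m → Fin n),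
      L.IsLowerTriangular ∧ IsUnit L ∧ U.IsUpperTriangular ∧ IsUnit U ∧ σ.Injective ∧
        x = L * selection K σ * U := by
  obtain ⟨A, B, hA, hA', hB, hB', hN⟩ := exists_lower_mul_mul_upper_isPartialMonomial x
  set N := A * x * B with hNdef
  have iA := hA'.invertible
  have iB := hB'.invertible
  have hxN : x = A⁻¹ * N * B⁻¹ := by simp [hNdef, Matrix.mul_assoc]
  have hrow : ∀ i, ∃ j, N i j ≠ 0 := by
    by_contra! h
    obtain ⟨i, hi⟩ := h
    have h0 : A i ᵥ* x = 0 := by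
      have : Pi.single i 1 ᵥ* N = 0 := by ext j; simp [hi]
      have e : A i = Pi.single i 1 ᵥ* A := by ext j; simp
      have hAx : A * x = N * B⁻¹ := by simp [hNdef, Matrix.mul_assoc]
      rw [e, vecMul_vecMul, hAx, ← vecMul_vecMul, this, zero_vecMul]
    have h1 : (A * A⁻¹) i i = 0 := by
      rw [mul_apply]; simp [hx _ h0]
    simp at h1
  choose σ hσ using hrow
  have hNσ : N = diagonal (fun i => N i (σ i)) * selection K σ := by
    ext i j
    rw [diagonal_mul]
    by_cases hj : j = σ i
    · simp [selection, hj]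
    · simp [selection, hj, (hN _ _ (hσ i)).1 j hj]
  refine ⟨A⁻¹ * diagonal (fun i => N i (σ i)), B⁻¹, σ,
    (hA.inv_of_isUnit hA').mul (blockTriangular_diagonal _), ?_, hB.inv_of_isUnit hB', ?_, ?_, ?_⟩
  · refine (isUnit_nonsing_inv_iff.2 hA').mul ?_
    rw [isUnit_diagonal, Pi.isUnit_iff]
    exact fun i => (hσ i).isUnit
  · exact isUnit_nonsing_inv_iff.2 hB'
  · intro i i' hii
    by_contra hne
    exact hσ i ((hN _ _ (hii ▸ hσ i')).2 i hne)
  · calc x = A⁻¹ * N * B⁻¹ := hxN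
      _ = _ := by rw [Matrix.mul_assoc A⁻¹ (diagonal _), ← hNσ]

/-- Arcs of lower-upper pairs through `(x, y)` are induced by deformations of the identity of
the field `K`: the pair `(x, y)` is the generic point of a component of the lower-upper scheme. -/
def Matrix.IsGenericLowerUpper (k : Type*) {K : Type*} [Field k] [Field K] [Algebra k K] {m n : ℕ}
    (x : Matrix (Fin m) (Fin n) K) (y : Matrix (Fin n) (Fin m) K) : Prop :=
  ∀ (x' : Matrix (Fin m) (Fin n) (PowerSeries K)) (y' : Matrix (Fin n) (Fin m) (PowerSeries K)),
    (x' * y').IsLowerTriangular → (y' * x').IsUpperTriangular →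
    x'.map PowerSeries.constantCoeff = x → y'.map PowerSeries.constantCoeff = y →
    ∃ φ : K →ₐ[k] PowerSeries K, (∀ a, PowerSeries.constantCoeff (φ a) = a) ∧
      x.map φ = x' ∧ y.map φ = y'

theorem Matrix.BlockTriangular.smul {ι α R : Type*} [LT α] [MulZeroClass R] {b : ι → α}
    {M : Matrix ι ι R} (c : R) (hM : M.BlockTriangular b) : (c • M).BlockTriangular b :=
  fun i j hij => by simp [hM hij]

theorem Matrix.det_map_C_add_X_smul_one_ne_zero {ι K : Type*} [Fintype ι] [DecidableEq ι]
    [Field K] (M : Matrix ι ι K) :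
    (M.map (PowerSeries.C (R := K)) + (PowerSeries.X : PowerSeries K) • 1).det ≠ 0 := by
  have h : (Polynomial.coeToPowerSeries.ringHom (R := K)) (-M).charpoly =
      (M.map (PowerSeries.C (R := K)) + (PowerSeries.X : PowerSeries K) • 1).det := by
    rw [charpoly, RingHom.map_det]
    congr 1
    ext1 i j
    by_cases hij : i = j
    · subst hij; simp [charmatrix, add_comm]
    · simp [charmatrix, hij]
  rw [← h, Ne, Polynomial.coeToPowerSeries.ringHom_apply, Polynomial.coe_eq_zero_iff]
  exact (charpoly_monic _).ne_zero

theorem Matrix.IsGenericLowerUpper.eq_zero_of_vecMul_eq_zero {k K : Type*} [Field k] [Field K]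
    [Algebra k K] {m n : ℕ} (hmn : m ≤ n) {x : Matrix (Fin m) (Fin n) K}
    {y : Matrix (Fin n) (Fin m) K} (h : IsGenericLowerUpper k x y)
    (hl : (x * y).IsLowerTriangular) (hu : (y * x).IsUpperTriangular) (v : Fin m → K)
    (hv : v ᵥ* x = 0) : v = 0 := by
  obtain ⟨z, z', hzz, hzl, hzu⟩ := exists_lower_upper_partner hmn y
  let c := PowerSeries.C (R := K)
  obtain ⟨φ, hφ, hφx, -⟩ := h (x.map c + (PowerSeries.X : PowerSeries K) • z.map c) (y.map c)
    (by
      rw [Matrix.add_mul, smul_mul, ← Matrix.map_mul, ← Matrix.map_mul]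
      exact (BlockTriangular.map c hl).add (BlockTriangular.smul _ (BlockTriangular.map c hzl)))
    (by
      rw [Matrix.mul_add, Matrix.mul_smul, ← Matrix.map_mul, ← Matrix.map_mul]
      exact (BlockTriangular.map c hu).add (BlockTriangular.smul _ (BlockTriangular.map c hzu)))
    (by ext i j; simp [c]) (by ext i j; simp [c])
  have h1 : (φ ∘ v) ᵥ* x.map φ = 0 := by
    ext1 j
    have := congrArg φ (congrFun hv j)
    simpa [vecMul, dotProduct] using this
  have h2 : (φ ∘ v) ᵥ* ((x * z').map c + (PowerSeries.X : PowerSeries K) • 1) = 0 := by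
    have e : (x * z').map c + (PowerSeries.X : PowerSeries K) • 1 = x.map φ * z'.map c := by
      rw [hφx, Matrix.add_mul, smul_mul, ← Matrix.map_mul, ← Matrix.map_mul, hzz]
      simp
    rw [e, ← vecMul_vecMul, h1, zero_vecMul]
  have h3 := Matrix.eq_zero_of_vecMul_eq_zero (det_map_C_add_X_smul_one_ne_zero (x * z')) h2
  ext i
  rw [← hφ (v i), show φ (v i) = 0 from congrFun h3 i]
  simp

/-- The tangent space at `x` to its orbit under lower triangular row operations and upper
triangular column operations. -/
def Matrix.lowerUpperTangent {K : Type*} [Field K] {m n : ℕ} (x : Matrix (Fin m) (Fin n) K) :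
    Submodule K (Matrix (Fin m) (Fin n) K) where
  carrier := {w | ∃ (α : Matrix (Fin m) (Fin m) K) (β : Matrix (Fin n) (Fin n) K),
    α.IsLowerTriangular ∧ β.IsUpperTriangular ∧ w = α * x + x * β}
  zero_mem' := ⟨0, 0, blockTriangular_zero, blockTriangular_zero, by simp⟩
  add_mem' := by
    rintro _ _ ⟨α, β, hα, hβ, rfl⟩ ⟨α', β', hα', hβ', rfl⟩
    exact ⟨α + α', β + β', hα.add hα', hβ.add hβ', by
      rw [Matrix.add_mul, Matrix.mul_add]; abel⟩
  smul_mem' := by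
    rintro c _ ⟨α, β, hα, hβ, rfl⟩
    exact ⟨c • α, c • β, hα.smul c, hβ.smul c, by simp⟩

/-- The matrices `v` forming a lower-upper pair with `x`. -/
def Matrix.lowerUpperFiber {K : Type*} [Field K] {m n : ℕ} (x : Matrix (Fin m) (Fin n) K) :
    Submodule K (Matrix (Fin n) (Fin m) K) where
  carrier := {v | (x * v).IsLowerTriangular ∧ (v * x).IsUpperTriangular}
  zero_mem' := ⟨by simp, by simp⟩
  add_mem' := by
    rintro v w ⟨h1, h2⟩ ⟨h3, h4⟩
    exact ⟨by rw [Matrix.mul_add]; exact h1.add h3, by rw [Matrix.add_mul]; exact h2.add h4⟩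
  smul_mem' := by
    rintro c v ⟨h1, h2⟩
    exact ⟨by rw [Matrix.mul_smul]; exact h1.smul c, by rw [Matrix.smul_mul]; exact h2.smul c⟩

/-- The trace pairing between `m × n` and `n × m` matrices. -/
noncomputable def Matrix.tracePairing (K : Type*) [Field K] (m n : ℕ) :
    Matrix (Fin n) (Fin m) K ≃ₗ[K] Module.Dual K (Matrix (Fin m) (Fin n) K) :=
  LinearEquiv.ofInjectiveOfFinrankEq
    (LinearMap.mk₂ K (fun v a => (a * v).trace) (by simp [Matrix.mul_add]) (by simp)
      (by simp [Matrix.add_mul]) (by simp))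
    (fun v w h => ext_iff_trace_mul_left.2 fun a => LinearMap.congr_fun h a)
    (by simp [Subspace.dual_finrank_eq, Module.finrank_matrix, mul_comm])

theorem Matrix.tracePairing_apply {K : Type*} [Field K] {m n : ℕ} (v : Matrix (Fin n) (Fin m) K)
    (a : Matrix (Fin m) (Fin n) K) : tracePairing K m n v a = (a * v).trace := rfl

theorem Matrix.BlockTriangular.diag_mul {ι α R : Type*} [Fintype ι] [LinearOrder α]
    [NonUnitalNonAssocSemiring R] {b : ι → α} (hb : b.Injective) {M N : Matrix ι ι R}
    (hM : M.BlockTriangular b) (hN : N.BlockTriangular b) (i : ι) :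
    (M * N) i i = M i i * N i i := by
  rw [mul_apply, Finset.sum_eq_single i]
  · intro j _ hji
    rcases lt_or_gt_of_ne (hb.ne hji) with h | h
    · rw [hM h, zero_mul]
    · rw [hN h, mul_zero]
  · simp

/-- The orthogonal of the orbit tangent space consists of the `v` for which `x * v` and `v * x`
are strictly triangular. -/
theorem Matrix.tracePairing_mem_dualAnnihilator_iff {K : Type*} [Field K] {m n : ℕ}
    {x : Matrix (Fin m) (Fin n) K} {v : Matrix (Fin n) (Fin m) K} :
    tracePairing K m n v ∈ (lowerUpperTangent x).dualAnnihilator ↔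
      v ∈ lowerUpperFiber x ∧ (∀ i, (x * v) i i = 0) ∧ ∀ j, (v * x) j j = 0 := by
  rw [Submodule.mem_dualAnnihilator]
  constructor
  · intro h
    have h1 : ∀ i i', i ≤ i' → (x * v) i i' = 0 := by
      intro i i' hi
      have := h (single i' i 1 * x + x * 0)
        ⟨_, 0, blockTriangular_single (b := OrderDual.toDual) (i := i') (j := i)
          (OrderDual.toDual_le_toDual.2 hi) 1,
          blockTriangular_zero, rfl⟩
      simpa [tracePairing_apply, Matrix.mul_assoc, trace_single_mul] using this
    have h2 : ∀ j j', j' ≤ j → (v * x) j j' = 0 := by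
      intro j j' hj
      have := h (0 * x + x * single j' j 1)
        ⟨0, _, blockTriangular_zero, blockTriangular_single hj _, rfl⟩
      rw [tracePairing_apply, Matrix.zero_mul, zero_add, Matrix.mul_assoc, trace_mul_comm,
        Matrix.mul_assoc] at this
      simpa [trace_single_mul] using this
    exact ⟨⟨fun i i' hi => h1 i i' (OrderDual.toDual_lt_toDual.1 hi).le,
      fun j j' hj => h2 j j' (le_of_lt hj)⟩, fun i => h1 i i le_rfl, fun j => h2 j j le_rfl⟩
  · rintro ⟨⟨hl, hu⟩, h1, h2⟩ _ ⟨α, β, hα, hβ, rfl⟩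
    rw [tracePairing_apply, Matrix.add_mul, trace_add, Matrix.mul_assoc, Matrix.mul_assoc,
      trace_mul_comm x, Matrix.mul_assoc]
    simp [trace, hα.diag_mul OrderDual.toDual.injective hl, hβ.diag_mul Function.injective_id hu,
      h1, h2]

theorem Matrix.diag_mul_eq_zero_of_mem_lowerUpperFiber {K : Type*} [Field K] {m n : ℕ}
    {x : Matrix (Fin m) (Fin n) K} {v : Matrix (Fin n) (Fin m) K} (hv : v ∈ lowerUpperFiber x)
    (h : ∀ i, (x * v) i i = 0) (j : Fin n) : (v * x) j j = 0 := by
  have h1 : (x * v).charpoly = Polynomial.X ^ m := by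
    rw [← charpoly_transpose, charpoly_of_isUpperTriangular (x * v)ᵀ
      fun i j hij => hv.1 (OrderDual.toDual_lt_toDual.2 hij)]
    simp [h]
  have h2 := charpoly_mul_comm' x v
  rw [h1, charpoly_of_isUpperTriangular _ hv.2] at h2
  have h3 := congrArg (Polynomial.eval ((v * x) j j)) h2
  have h4 : ∏ i, ((v * x) j j - (v * x) i i) = 0 :=
    Finset.prod_eq_zero (Finset.mem_univ j) (sub_self _)
  simp only [Polynomial.eval_mul, Polynomial.eval_prod, Polynomial.eval_pow, Polynomial.eval_X,
    Polynomial.eval_sub, Polynomial.eval_C, h4, mul_zero, mul_eq_zero] at h3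
  exact h3.elim eq_zero_of_pow_eq_zero eq_zero_of_pow_eq_zero

theorem Matrix.exists_mem_lowerUpperFiber {K : Type*} [Field K] {m n : ℕ}
    {x : Matrix (Fin m) (Fin n) K} {L : Matrix (Fin m) (Fin m) K} {U : Matrix (Fin n) (Fin n) K}
    {σ : Fin m → Fin n} (hL : L.IsLowerTriangular) (hL' : IsUnit L) (hU : U.IsUpperTriangular)
    (hU' : IsUnit U) (hσ : σ.Injective) (hx : x = L * selection K σ * U) (d : Fin m → K) :
    ∃ v ∈ lowerUpperFiber x, ∀ i, (x * v) i i = d i := by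
  have := hU'.invertible
  have := hL'.invertible
  let v := U⁻¹ * (selection K σ)ᵀ * diagonal d * L⁻¹
  have h1 : x * v = L * diagonal d * L⁻¹ :=
    calc x * v = L * (selection K σ * (selection K σ)ᵀ) * diagonal d * L⁻¹ := by
          simp [v, hx, Matrix.mul_assoc]
      _ = L * diagonal d * L⁻¹ := by simp [selection_mul_transpose hσ]
  have h2 : v * x = U⁻¹ * ((selection K σ)ᵀ * diagonal d * selection K σ) * U := by
    simp [v, hx, Matrix.mul_assoc]
  have h3 : ((selection K σ)ᵀ * diagonal d * selection K σ).IsUpperTriangular := by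
    intro j j' hj
    rw [mul_apply, Finset.sum_eq_zero]
    intro i _
    rw [mul_diagonal]
    by_cases h : j = σ i
    · have : j' ≠ σ i := h ▸ hj.ne
      simp [selection, this]
    · simp [selection, h]
  have hL'' := hL.inv_of_isUnit hL'
  have hd : (diagonal d).IsLowerTriangular := blockTriangular_diagonal _
  refine ⟨v, ⟨?_, ?_⟩, fun i => ?_⟩
  · rw [h1]; exact (hL.mul hd).mul hL''
  · rw [h2]; exact ((hU.inv_of_isUnit hU').mul h3).mul hU
  · have hLi : L i i * L⁻¹ i i = 1 := by
      rw [← hL.diag_mul OrderDual.toDual.injective hL'']; simp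
    rw [h1, (hL.mul hd).diag_mul OrderDual.toDual.injective hL'', mul_diagonal, mul_right_comm, hLi,
      one_mul]

theorem Matrix.finrank_lowerUpperTangent_add_finrank_lowerUpperFiber {K : Type*} [Field K]
    {m n : ℕ} {x : Matrix (Fin m) (Fin n) K} {L : Matrix (Fin m) (Fin m) K}
    {U : Matrix (Fin n) (Fin n) K} {σ : Fin m → Fin n} (hL : L.IsLowerTriangular) (hL' : IsUnit L)
    (hU : U.IsUpperTriangular) (hU' : IsUnit U) (hσ : σ.Injective)
    (hx : x = L * selection K σ * U) :
    Module.finrank K (lowerUpperTangent x) + Module.finrank K (lowerUpperFiber x) =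
      m * (n + 1) := by
  let δ : lowerUpperFiber x →ₗ[K] (Fin m → K) :=
    { toFun := fun v i => (x * v.1) i i
      map_add' := fun v w => by ext i; simp [Matrix.mul_add]
      map_smul' := fun c v => by ext i; simp }
  have hδ : LinearMap.range δ = ⊤ := by
    rw [LinearMap.range_eq_top]
    intro d
    obtain ⟨v, hv, hd⟩ := exists_mem_lowerUpperFiber hL hL' hU hU' hσ hx d
    exact ⟨⟨v, hv⟩, funext hd⟩
  let V := (lowerUpperTangent x).dualAnnihilator.comap
    (tracePairing K m n : Matrix (Fin n) (Fin m) K →ₗ[K] _)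
  have hV : V ≤ lowerUpperFiber x := fun v hv => (tracePairing_mem_dualAnnihilator_iff.1 hv).1
  have hker : LinearMap.ker δ = V.comap (lowerUpperFiber x).subtype := by
    ext v
    have : v ∈ V.comap (lowerUpperFiber x).subtype ↔ _ := tracePairing_mem_dualAnnihilator_iff
    rw [this, LinearMap.mem_ker]
    exact ⟨fun h => ⟨v.2, congrFun h,
      diag_mul_eq_zero_of_mem_lowerUpperFiber v.2 (congrFun h)⟩, fun h => funext h.2.1⟩
  have h1 := LinearMap.finrank_range_add_finrank_ker δ
  rw [hδ, finrank_top, Module.finrank_fin_fun, hker,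
    (Submodule.comapSubtypeEquivOfLe hV).finrank_eq] at h1
  have h2 : Module.finrank K V = Module.finrank K (lowerUpperTangent x).dualAnnihilator := by
    have : V = (lowerUpperTangent x).dualAnnihilator.map
        ((tracePairing K m n).symm : _ →ₗ[K] Matrix (Fin n) (Fin m) K) := by
      ext v
      rw [Submodule.mem_map_equiv]
      rfl
    rw [this]
    exact LinearEquiv.finrank_map_eq (tracePairing K m n).symm _
  have h3 := Subspace.finrank_add_finrank_dualAnnihilator_eq (lowerUpperTangent x)
  rw [Module.finrank_matrix] at h3
  simp at h3
  rw [Nat.mul_succ]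
  omega

/-- The derivation read off from a first order deformation of the identity. -/
noncomputable def Derivation.ofPowerSeries {k K : Type*} [Field k] [Field K] [Algebra k K]
    (φ : K →ₐ[k] PowerSeries K) (hφ : ∀ a, PowerSeries.constantCoeff (φ a) = a) :
    Derivation k K K :=
  Derivation.mk' ({
    toFun := fun a => PowerSeries.coeff 1 (φ a)
    map_add' := by simp
    map_smul' := by simp } : K →ₗ[k] K) (by
      intro a b
      simp [PowerSeries.coeff_one_mul, hφ, mul_comm, add_comm])

/-- The generic point of a component of the lower-upper scheme specializes along any arc of
lower-upper pairs through it. -/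
theorem exists_algHom_powerSeries_of_mem_minimalPrimes {m n : ℕ} {P : Ideal (LUPolyRing m n)}
    (hP : P ∈ (idealE m n).minimalPrimes) {K : Type*} [Field K] [Algebra ℂ K]
    [Algebra (LUPolyRing m n ⧸ P) K] [IsFractionRing (LUPolyRing m n ⧸ P) K]
    [IsScalarTower ℂ (LUPolyRing m n ⧸ P) K]
    (x' : Matrix (Fin m) (Fin n) (PowerSeries K)) (y' : Matrix (Fin n) (Fin m) (PowerSeries K))
    (hl : (x' * y').IsLowerTriangular) (hu : (y' * x').IsUpperTriangular)
    (hx : ∀ i j, PowerSeries.constantCoeff (x' i j) =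
      algebraMap (LUPolyRing m n ⧸ P) K (Ideal.Quotient.mk P (genX m n i j)))
    (hy : ∀ j i, PowerSeries.constantCoeff (y' j i) =
      algebraMap (LUPolyRing m n ⧸ P) K (Ideal.Quotient.mk P (genY m n j i))) :
    ∃ φ : K →ₐ[ℂ] PowerSeries K, (∀ a, PowerSeries.constantCoeff (φ a) = a) ∧
      (∀ i j, φ (algebraMap (LUPolyRing m n ⧸ P) K (Ideal.Quotient.mk P (genX m n i j))) =
        x' i j) ∧
      ∀ j i, φ (algebraMap (LUPolyRing m n ⧸ P) K (Ideal.Quotient.mk P (genY m n j i))) =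
        y' j i := by
  have hPp : P.IsPrime := hP.1.1
  let ψ : LUPolyRing m n →ₐ[ℂ] PowerSeries K :=
    MvPolynomial.aeval (Sum.elim (fun p => x' p.1 p.2) fun p => y' p.1 p.2)
  have hψx : (genX m n).map ψ = x' := by ext i j; simp [ψ, genX]
  have hψy : (genY m n).map ψ = y' := by ext i j; simp [ψ, genY]
  let ι : LUPolyRing m n →ₐ[ℂ] K :=
    (IsScalarTower.toAlgHom ℂ (LUPolyRing m n ⧸ P) K).comp (Ideal.Quotient.mkₐ ℂ P)
  have hψι : ∀ r, PowerSeries.constantCoeff (ψ r) = ι r := by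
    let c : PowerSeries K →ₐ[ℂ] K :=
      { PowerSeries.constantCoeff (R := K) with
        commutes' := fun r => by simp [PowerSeries.algebraMap_apply] }
    have : c.comp ψ = ι := by
      ext p
      rcases p with p | p
      · simpa [c, ψ, ι, genX] using hx p.1 p.2
      · simpa [c, ψ, ι, genY] using hy p.1 p.2
    exact fun r => DFunLike.congr_fun this r
  have hker : P ≤ RingHom.ker ψ := by
    refine hP.2 ⟨RingHom.ker_isPrime _, ?_⟩ ?_
    · rw [idealE, Ideal.span_le]
      rintro q (⟨i, i', hi, rfl⟩ | ⟨j, j', hj, rfl⟩)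
      · have : ψ ((genX m n * genY m n) i i') = (x' * y') i i' := by
          rw [← hψx, ← hψy, ← Matrix.map_mul]; rfl
        exact this.trans (hl (OrderDual.toDual_lt_toDual.2 hi))
      · have : ψ ((genY m n * genX m n) j j') = (y' * x') j j' := by
          rw [← hψx, ← hψy, ← Matrix.map_mul]; rfl
        exact this.trans (hu hj)
    · intro r hr
      have h0 : ι r = 0 := by rw [← hψι, show ψ r = 0 from hr, map_zero]
      have := (FaithfulSMul.algebraMap_injective (LUPolyRing m n ⧸ P) K)
        (h0.trans (map_zero (algebraMap _ K)).symm)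
      exact Ideal.Quotient.eq_zero_iff_mem.1 this
  let ψ₀ : (LUPolyRing m n ⧸ P) →ₐ[ℂ] PowerSeries K := Ideal.Quotient.liftₐ P ψ hker
  have hψ₀ : ∀ a, PowerSeries.constantCoeff (ψ₀ a) = algebraMap _ K a := by
    intro a
    obtain ⟨r, rfl⟩ := Ideal.Quotient.mk_surjective a
    exact hψι r
  have hunit : ∀ s : nonZeroDivisors (LUPolyRing m n ⧸ P), IsUnit (ψ₀ s) := by
    intro s
    rw [PowerSeries.isUnit_iff_constantCoeff, hψ₀]
    exact IsLocalization.map_units K s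
  let φ : K →ₐ[ℂ] PowerSeries K := IsLocalization.liftAlgHom (f := ψ₀) hunit
  have hφ : ∀ a, φ (algebraMap _ K a) = ψ₀ a := fun a => IsLocalization.lift_eq hunit a
  refine ⟨φ, ?_, ?_, ?_⟩
  · have : (PowerSeries.constantCoeff (R := K)).comp (φ : K →+* PowerSeries K) = RingHom.id K := by
      refine IsLocalization.ringHom_ext (nonZeroDivisors (LUPolyRing m n ⧸ P)) ?_
      exact RingHom.ext fun a => by simp [hφ, hψ₀]
    exact fun a => RingHom.congr_fun this a
  · intro i j
    rw [hφ, ← hψx]; rfl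
  · intro i j
    rw [hφ, ← hψy]; rfl

theorem Derivation.map_matrix_mul {k K ι κ μ : Type*} [Fintype κ] [CommSemiring k]
    [CommSemiring K] [Algebra k K] (D : Derivation k K K) (M : Matrix ι κ K) (N : Matrix κ μ K) :
    (M * N).map D = M.map D * N + M * N.map D := by
  ext i j
  simp only [map_apply, Matrix.add_apply, mul_apply, map_sum, Derivation.leibniz,
    Finset.sum_add_distrib, smul_eq_mul]
  rw [add_comm]
  simp_rw [mul_comm (N _ _)]

theorem PowerSeries.map_coeff_one_matrix_mul {R ι κ μ : Type*} [Fintype κ] [CommSemiring R]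
    (M : Matrix ι κ (PowerSeries R)) (N : Matrix κ μ (PowerSeries R)) :
    (M * N).map (coeff (R := R) 1) = M.map (coeff (R := R) 1) * N.map (constantCoeff (R := R)) +
      M.map (constantCoeff (R := R)) * N.map (coeff (R := R) 1) := by
  ext i j
  simp only [map_apply, Matrix.add_apply, mul_apply, map_sum, PowerSeries.coeff_one_mul,
    Finset.sum_add_distrib]
  simp_rw [mul_comm (constantCoeff (M _ _))]

/-- The arc `1 + tα` of invertible matrices. -/
noncomputable def Matrix.oneAddXSMul {ι K : Type*} [DecidableEq ι] [Field K] (α : Matrix ι ι K) :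
    Matrix ι ι (PowerSeries K) :=
  1 + (PowerSeries.X : PowerSeries K) • α.map (PowerSeries.C (R := K))

namespace Matrix

variable {ι K : Type*} [DecidableEq ι] [Field K]

theorem oneAddXSMul_map_constantCoeff (α : Matrix ι ι K) :
    (oneAddXSMul α).map (PowerSeries.constantCoeff (R := K)) = 1 := by
  ext i j
  simp [oneAddXSMul, one_apply, apply_ite]

theorem oneAddXSMul_map_coeff_one (α : Matrix ι ι K) :
    (oneAddXSMul α).map (PowerSeries.coeff (R := K) 1) = α := by
  ext i j
  simp [oneAddXSMul, one_apply, apply_ite, PowerSeries.coeff_one]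

theorem isUnit_oneAddXSMul [Fintype ι] (α : Matrix ι ι K) : IsUnit (oneAddXSMul α) := by
  rw [isUnit_iff_isUnit_det, PowerSeries.isUnit_iff_constantCoeff, RingHom.map_det,
    RingHom.mapMatrix_apply, oneAddXSMul_map_constantCoeff]
  simp

theorem oneAddXSMul_inv_map_constantCoeff [Fintype ι] (α : Matrix ι ι K) :
    (oneAddXSMul α)⁻¹.map (PowerSeries.constantCoeff (R := K)) = 1 := by
  have := (isUnit_oneAddXSMul α).invertible
  have h := congrArg (PowerSeries.constantCoeff (R := K)).mapMatrix
    (mul_inv_of_invertible (oneAddXSMul α))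
  rwa [map_mul, map_one, RingHom.mapMatrix_apply, oneAddXSMul_map_constantCoeff, one_mul] at h

theorem BlockTriangular.oneAddXSMul {γ : Type*} [LinearOrder γ] {b : ι → γ} {α : Matrix ι ι K}
    (hα : α.BlockTriangular b) : (oneAddXSMul α).BlockTriangular b :=
  blockTriangular_one.add ((hα.map (PowerSeries.C (R := K))).smul _)

end Matrix

section

variable {k K : Type*} [Field k] [Field K] [Algebra k K] {m n : ℕ}

/-- The value of a derivation on the entries of a matrix. -/
def Derivation.matrixEval (k : Type*) [Field k] [Algebra k K] (x : Matrix (Fin m) (Fin n) K) :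
    Derivation k K K →ₗ[K] Matrix (Fin m) (Fin n) K where
  toFun D := x.map D
  map_add' _ _ := by ext; simp
  map_smul' _ _ := by ext; simp

theorem Derivation.matrixEval_apply (x : Matrix (Fin m) (Fin n) K) (D : Derivation k K K) :
    matrixEval k x D = x.map D := rfl

theorem Derivation.map_selection (D : Derivation k K K) (σ : Fin m → Fin n) :
    (selection K σ).map D = 0 := by
  ext i j
  simp [selection, apply_ite]

theorem Derivation.map_mem_lowerUpperTangent (D : Derivation k K K) {x : Matrix (Fin m) (Fin n) K}
    {L : Matrix (Fin m) (Fin m) K} {U : Matrix (Fin n) (Fin n) K} {σ : Fin m → Fin n}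
    (hL : L.IsLowerTriangular) (hL' : IsUnit L) (hU : U.IsUpperTriangular) (hU' : IsUnit U)
    (hx : x = L * selection K σ * U) : x.map D ∈ lowerUpperTangent x := by
  have := hU'.invertible
  have := hL'.invertible
  refine ⟨L.map D * L⁻¹, U⁻¹ * U.map D, BlockTriangular.mul (BlockTriangular.map D hL)
    (hL.inv_of_isUnit hL'), BlockTriangular.mul (hU.inv_of_isUnit hU') (BlockTriangular.map D hU),
    ?_⟩
  simp [hx, D.map_matrix_mul, D.map_selection, Matrix.mul_assoc]

theorem Matrix.IsGenericLowerUpper.range_matrixEval {x : Matrix (Fin m) (Fin n) K}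
    {y : Matrix (Fin n) (Fin m) K} (h : IsGenericLowerUpper k x y)
    (hl : (x * y).IsLowerTriangular) (hu : (y * x).IsUpperTriangular)
    {L : Matrix (Fin m) (Fin m) K} {U : Matrix (Fin n) (Fin n) K} {σ : Fin m → Fin n}
    (hL : L.IsLowerTriangular) (hL' : IsUnit L) (hU : U.IsUpperTriangular) (hU' : IsUnit U)
    (hx : x = L * selection K σ * U) :
    LinearMap.range (Derivation.matrixEval k x) = lowerUpperTangent x := by
  refine le_antisymm ?_ ?_
  · rintro _ ⟨D, rfl⟩
    exact D.map_mem_lowerUpperTangent hL hL' hU hU' hx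
  · rintro _ ⟨α, β, hα, hβ, rfl⟩
    let c := PowerSeries.C (R := K)
    have hc : ∀ {p q : ℕ} (M : Matrix (Fin p) (Fin q) K),
        (M.map c).map (PowerSeries.constantCoeff (R := K)) = M := fun M => by ext; simp [c]
    have hc1 : ∀ {p q : ℕ} (M : Matrix (Fin p) (Fin q) K),
        (M.map c).map (PowerSeries.coeff (R := K) 1) = 0 := fun M => by
      ext; simp [c]
    have := (isUnit_oneAddXSMul α).invertible
    have := (isUnit_oneAddXSMul β).invertible
    obtain ⟨φ, hφ, hφx, -⟩ := h (oneAddXSMul α * x.map c * oneAddXSMul β)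
      ((oneAddXSMul β)⁻¹ * y.map c * (oneAddXSMul α)⁻¹)
      (by
        have e : oneAddXSMul α * x.map c * oneAddXSMul β *
            ((oneAddXSMul β)⁻¹ * y.map c * (oneAddXSMul α)⁻¹) =
            oneAddXSMul α * (x * y).map c * (oneAddXSMul α)⁻¹ := by
          simp [Matrix.mul_assoc]
        rw [e]
        exact (hα.oneAddXSMul.mul (BlockTriangular.map c hl)).mul
          (hα.oneAddXSMul.inv_of_isUnit (isUnit_oneAddXSMul α)))
      (by
        have e : (oneAddXSMul β)⁻¹ * y.map c * (oneAddXSMul α)⁻¹ *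
            (oneAddXSMul α * x.map c * oneAddXSMul β) =
            (oneAddXSMul β)⁻¹ * (y * x).map c * oneAddXSMul β := by
          simp [Matrix.mul_assoc]
        rw [e]
        exact ((hβ.oneAddXSMul.inv_of_isUnit (isUnit_oneAddXSMul β)).mul
          (BlockTriangular.map c hu)).mul hβ.oneAddXSMul)
      (by simp [Matrix.map_mul, oneAddXSMul_map_constantCoeff, hc])
      (by simp [Matrix.map_mul, oneAddXSMul_inv_map_constantCoeff, hc])
    refine ⟨Derivation.ofPowerSeries φ hφ, ?_⟩
    have : x.map (Derivation.ofPowerSeries φ hφ) = (x.map φ).map (PowerSeries.coeff (R := K) 1) := by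
      ext; rfl
    rw [Derivation.matrixEval_apply, this, hφx]
    simp [PowerSeries.map_coeff_one_matrix_mul, Matrix.map_mul, oneAddXSMul_map_constantCoeff,
      oneAddXSMul_map_coeff_one, hc, hc1]

theorem Matrix.IsGenericLowerUpper.map_ker_matrixEval {x : Matrix (Fin m) (Fin n) K}
    {y : Matrix (Fin n) (Fin m) K} (h : IsGenericLowerUpper k x y)
    (hl : (x * y).IsLowerTriangular) (hu : (y * x).IsUpperTriangular) :
    (LinearMap.ker (Derivation.matrixEval k x)).map (Derivation.matrixEval k y) =
      lowerUpperFiber x := by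
  refine le_antisymm ?_ ?_
  · rintro _ ⟨D, hD, rfl⟩
    have hD : x.map D = 0 := hD
    constructor
    · have : (x * y).map D = x * y.map D := by rw [D.map_matrix_mul, hD]; simp
      rw [Derivation.matrixEval_apply, ← this]
      exact BlockTriangular.map D hl
    · have : (y * x).map D = y.map D * x := by rw [D.map_matrix_mul, hD]; simp
      rw [Derivation.matrixEval_apply, ← this]
      exact BlockTriangular.map D hu
  · rintro v ⟨hvl, hvu⟩
    let c := PowerSeries.C (R := K)
    obtain ⟨φ, hφ, hφx, hφy⟩ := h (x.map c) (y.map c + (PowerSeries.X : PowerSeries K) • v.map c)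
      (by
        rw [Matrix.mul_add, Matrix.mul_smul, ← Matrix.map_mul, ← Matrix.map_mul]
        exact BlockTriangular.add (BlockTriangular.map c hl)
          (BlockTriangular.smul _ (BlockTriangular.map c hvl)))
      (by
        rw [Matrix.add_mul, Matrix.smul_mul, ← Matrix.map_mul, ← Matrix.map_mul]
        exact BlockTriangular.add (BlockTriangular.map c hu)
          (BlockTriangular.smul _ (BlockTriangular.map c hvu)))
      (by ext; simp [c]) (by ext; simp [c])
    refine ⟨Derivation.ofPowerSeries φ hφ, ?_, ?_⟩
    · have : x.map (Derivation.ofPowerSeries φ hφ) =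
          (x.map φ).map (PowerSeries.coeff (R := K) 1) := by ext; rfl
      rw [SetLike.mem_coe, LinearMap.mem_ker, Derivation.matrixEval_apply, this, hφx]
      ext; simp [c]
    · have : y.map (Derivation.ofPowerSeries φ hφ) =
          (y.map φ).map (PowerSeries.coeff (R := K) 1) := by ext; rfl
      rw [Derivation.matrixEval_apply, this, hφy]
      ext; simp [c]

theorem Matrix.IsGenericLowerUpper.finrank_derivation [Module.Finite K (Derivation k K K)]
    (hmn : m ≤ n) {x : Matrix (Fin m) (Fin n) K} {y : Matrix (Fin n) (Fin m) K}
    (h : IsGenericLowerUpper k x y) (hl : (x * y).IsLowerTriangular)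
    (hu : (y * x).IsUpperTriangular)
    (hgen : ∀ D : Derivation k K K, x.map D = 0 → y.map D = 0 → D = 0) :
    Module.finrank K (Derivation k K K) = m * (n + 1) := by
  obtain ⟨L, U, σ, hL, hL', hU, hU', hσ, hx⟩ :=
    exists_eq_lower_mul_selection_mul_upper x (h.eq_zero_of_vecMul_eq_zero hmn hl hu)
  rw [← finrank_lowerUpperTangent_add_finrank_lowerUpperFiber hL hL' hU hU' hσ hx,
    ← LinearMap.finrank_range_add_finrank_ker (Derivation.matrixEval k x),
    h.range_matrixEval hl hu hL hL' hU hU' hx, ← h.map_ker_matrixEval hl hu,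
    ← LinearMap.range_domRestrict, LinearMap.finrank_range_of_inj]
  rw [← LinearMap.ker_eq_bot, LinearMap.ker_eq_bot']
  exact fun D hD => Subtype.ext (hgen D D.2 hD)

end

end LowerUpper

theorem Derivation.eq_zero_of_map_genX_of_map_genY {m n : ℕ} {P : Ideal (LUPolyRing m n)}
    {K : Type*} [Field K] [Algebra ℂ K] [Algebra (LUPolyRing m n ⧸ P) K]
    [IsFractionRing (LUPolyRing m n ⧸ P) K] [IsScalarTower ℂ (LUPolyRing m n ⧸ P) K]
    (D : Derivation ℂ K K)
    (hx : ∀ i j, D (algebraMap (LUPolyRing m n ⧸ P) K (Ideal.Quotient.mk P (genX m n i j))) = 0)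
    (hy : ∀ j i, D (algebraMap (LUPolyRing m n ⧸ P) K (Ideal.Quotient.mk P (genY m n j i))) = 0) :
    D = 0 := by
  have h1 : ∀ r, D (algebraMap (LUPolyRing m n ⧸ P) K (Ideal.Quotient.mk P r)) = 0 := by
    intro r
    induction r using MvPolynomial.induction_on with
    | C a =>
      have : algebraMap (LUPolyRing m n ⧸ P) K (Ideal.Quotient.mk P (MvPolynomial.C a)) =
          algebraMap ℂ K a := by
        rw [IsScalarTower.algebraMap_apply ℂ (LUPolyRing m n ⧸ P) K]; rfl
      rw [this, D.map_algebraMap]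
    | add p q hp hq => simp [hp, hq]
    | mul_X p i hp =>
      rcases i with i | i
      · have := hx i.1 i.2
        simp [hp, genX] at this ⊢
        simp [this]
      · have := hy i.1 i.2
        simp [hp, genY] at this ⊢
        simp [this]
  ext a
  obtain ⟨p, q, hq, rfl⟩ := IsFractionRing.div_surjective (LUPolyRing m n ⧸ P) a
  obtain ⟨p, rfl⟩ := Ideal.Quotient.mk_surjective p
  obtain ⟨q, rfl⟩ := Ideal.Quotient.mk_surjective q
  simp [Derivation.leibniz_div, h1]

/-- The lower-upper scheme is equidimensional of dimension `m(n+1)`. -/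
theorem lowerUpper_equidimensional (m n : ℕ) (hm : 1 ≤ m) (hmn : m ≤ n)
    (P : Ideal (LUPolyRing m n)) (hP : P ∈ (idealE m n).minimalPrimes) :
    ringKrullDim (LUPolyRing m n ⧸ P) = (m * (n + 1) : ℕ) := by
  have hPp : P.IsPrime := hP.1.1
  let K := FractionRing (LUPolyRing m n ⧸ P)
  obtain ⟨hfin, hdim⟩ := ringKrullDim_eq_finrank_derivation ℂ (LUPolyRing m n ⧸ P) K
  let ι : LUPolyRing m n →+* K := (algebraMap _ K).comp (Ideal.Quotient.mk P)
  have hι : ∀ r ∈ idealE m n, ι r = 0 := fun r hr => by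
    simp [ι, Ideal.Quotient.eq_zero_iff_mem.2 (hP.1.2 hr)]
  have hgeneric : Matrix.IsGenericLowerUpper ℂ ((genX m n).map ι) ((genY m n).map ι) := by
    intro x' y' hl hu hx hy
    obtain ⟨φ, hφ, hφx, hφy⟩ := exists_algHom_powerSeries_of_mem_minimalPrimes hP x' y' hl hu
      (fun i j => congrFun (congrFun hx i) j) (fun j i => congrFun (congrFun hy j) i)
    exact ⟨φ, hφ, Matrix.ext hφx, Matrix.ext hφy⟩
  have hl : ((genX m n).map ι * (genY m n).map ι).IsLowerTriangular := by
    rw [← Matrix.map_mul]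
    exact fun i i' hi => hι _ <|
      Ideal.subset_span (Or.inl ⟨i, i', OrderDual.toDual_lt_toDual.1 hi, rfl⟩)
  have hu : ((genY m n).map ι * (genX m n).map ι).IsUpperTriangular := by
    rw [← Matrix.map_mul]
    exact fun j j' hj => hι _ <| Ideal.subset_span (Or.inr ⟨j, j', hj, rfl⟩)
  rw [hdim, hgeneric.finrank_derivation hmn hl hu fun D hx hy =>
    D.eq_zero_of_map_genX_of_map_genY (P := P) (fun i j => congrFun (congrFun hx i) j)
      (fun j i => congrFun (congrFun hy j) i)]
end
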